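/- arXiv:1307.2842 — 3 statements merged into one kernel-verified Lean document; each statement's English description precedes it below -/
import Mathlib

section
/- There exists z₀ > 0 such that for each j ∈ {1,2,3,4} the function z ↦ |a_{Lj}(λ,z)| is strictly increasing on the real interval [z₀, +∞). -/
open MeasureTheory Set Filter

noncomputable def Cfun (c : ℝ → ℝ) (Omegam K : ℝ) (x : ℝ) : ℝ :=
  (∫ s in Iic x, (c s - Omegam)) + Omegam * x + K

noncomputable def qfun (a c : ℝ → ℝ) (Omegam K : ℝ) (x : ℝ) : ℂ :=
  (a x : ℂ) * Complex.exp (2 * Complex.I * ((Cfun c Omegam K x : ℝ) : ℂ))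

noncomputable def mL1 (q : ℝ → ℂ) (lam : ℝ) : ℕ → ℝ → ℂ
  | 0, _ => 1
  | n + 1, x =>
      ∫ y in Ioi x, (∫ t in Ioi y,
        Complex.exp (2 * Complex.I * (lam : ℂ) * ((t : ℂ) - (y : ℂ))) * q y *
          (starRingEnd ℂ) (q t) * mL1 q lam n t)

noncomputable def mL2 (q : ℝ → ℂ) (lam : ℝ) : ℕ → ℝ → ℂ
  | 0, x =>
      -Complex.I * (∫ y in Ioi x,
        Complex.exp (-(2 * Complex.I * (lam : ℂ) * ((y : ℂ) - (x : ℂ)))) * q y)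
  | n + 1, x =>
      ∫ y in Ioi x, (∫ t in Ioi y,
        Complex.exp (-(2 * Complex.I * (lam : ℂ) * ((y : ℂ) - (x : ℂ)))) * q y *
          (starRingEnd ℂ) (q t) * mL2 q lam n t)

noncomputable def mL3 (q : ℝ → ℂ) (lam : ℝ) : ℕ → ℝ → ℂ
  | 0, x =>
      Complex.I * (∫ y in Ioi x,
        Complex.exp (2 * Complex.I * (lam : ℂ) * ((y : ℂ) - (x : ℂ))) * (starRingEnd ℂ) (q y))
  | n + 1, x =>
      ∫ y in Ioi x, (∫ t in Ioi y,
        Complex.exp (2 * Complex.I * (lam : ℂ) * ((y : ℂ) - (x : ℂ))) * (starRingEnd ℂ) (q y) *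
          q t * mL3 q lam n t)

noncomputable def mL4 (q : ℝ → ℂ) (lam : ℝ) : ℕ → ℝ → ℂ
  | 0, _ => 1
  | n + 1, x =>
      ∫ y in Ioi x, (∫ t in Ioi y,
        Complex.exp (-(2 * Complex.I * (lam : ℂ) * ((t : ℂ) - (y : ℂ)))) * (starRingEnd ℂ) (q y) *
          q t * mL4 q lam n t)

noncomputable def ML1 (q : ℝ → ℂ) (lam : ℝ) (x : ℝ) (z : ℂ) : ℂ :=
  ∑' n : ℕ, mL1 q lam n x * z ^ (2 * n)

noncomputable def ML2 (q : ℝ → ℂ) (lam : ℝ) (x : ℝ) (z : ℂ) : ℂ :=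
  ∑' n : ℕ, mL2 q lam n x * z ^ (2 * n + 1)

noncomputable def ML3 (q : ℝ → ℂ) (lam : ℝ) (x : ℝ) (z : ℂ) : ℂ :=
  ∑' n : ℕ, mL3 q lam n x * z ^ (2 * n + 1)

noncomputable def ML4 (q : ℝ → ℂ) (lam : ℝ) (x : ℝ) (z : ℂ) : ℂ :=
  ∑' n : ℕ, mL4 q lam n x * z ^ (2 * n)

noncomputable def aL1 (q : ℝ → ℂ) (lam : ℝ) (z : ℂ) : ℂ :=
  1 - Complex.I * z * (∫ x : ℝ, q x * ML3 q lam x z)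

noncomputable def aL2 (q : ℝ → ℂ) (lam : ℝ) (z : ℂ) : ℂ :=
  -Complex.I * z * (∫ x : ℝ, Complex.exp (-(2 * Complex.I * (lam : ℂ) * (x : ℂ))) * q x * ML4 q lam x z)

noncomputable def aL3 (q : ℝ → ℂ) (lam : ℝ) (z : ℂ) : ℂ :=
  Complex.I * z * (∫ x : ℝ, Complex.exp (2 * Complex.I * (lam : ℂ) * (x : ℂ)) * (starRingEnd ℂ) (q x) * ML1 q lam x z)

noncomputable def aL4 (q : ℝ → ℂ) (lam : ℝ) (z : ℂ) : ℂ :=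
  1 + Complex.I * z * (∫ x : ℝ, (starRingEnd ℂ) (q x) * ML2 q lam x z)

section Helper

lemma tail_hasDerivAt {E : Type*} [NormedAddCommGroup E] [NormedSpace ℝ E] [CompleteSpace E]
    {g : ℝ → E} (hc : Continuous g) (hi : Integrable g) (x : ℝ) :
    HasDerivAt (fun x => ∫ y in Ioi x, g y) (-g x) x := by
  have h : (fun x => ∫ y in Ioi x, g y) = fun x => (∫ y in Ioi (0:ℝ), g y) - ∫ y in (0:ℝ)..x, g y := by
    funext x
    rw [← intervalIntegral.integral_interval_add_Ioi (a := 0) (b := x) hi.integrableOn hi.integrableOn]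
    simp
  rw [h]
  have := (intervalIntegral.integral_hasDerivAt_right (hc.intervalIntegrable 0 x)
    (hc.stronglyMeasurableAtFilter _ _) hc.continuousAt).const_sub (∫ y in Ioi (0:ℝ), g y)
  exact this

lemma tail_tendsto_atBot {E : Type*} [NormedAddCommGroup E] [NormedSpace ℝ E]
    {g : ℝ → E} (hi : Integrable g) :
    Tendsto (fun x => ∫ y in Ioi x, g y) atBot (nhds (∫ y, g y)) :=
  (aecover_Ioi tendsto_id).integral_tendsto_of_countably_generated hi

lemma tail_tendsto_atTop {E : Type*} [NormedAddCommGroup E] [NormedSpace ℝ E]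
    {g : ℝ → E} :
    Tendsto (fun x => ∫ y in Ioi x, g y) atTop (nhds 0) :=
  tendsto_integral_Ioi_zero tendsto_id

noncomputable def It : ℕ → (ℝ → ℂ) → (ℝ → ℂ) → ℝ → ℂ
  | 0, _, _, _ => 1
  | k + 1, Q1, Q2, x => ∫ y in Ioi x, Q1 y * It k Q2 Q1 y

lemma tail_nonneg {a : ℝ → ℝ} (h0 : ∀ x, 0 ≤ a x) (x : ℝ) : 0 ≤ ∫ y in Ioi x, a y :=
  integral_nonneg h0

lemma tail_le {a : ℝ → ℝ} (h0 : ∀ x, 0 ≤ a x) (ha : Integrable a) (x : ℝ) :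
    ∫ y in Ioi x, a y ≤ ∫ y, a y :=
  setIntegral_le_integral ha (Eventually.of_forall h0)

lemma integ_mul {a : ℝ → ℝ} (ha : Integrable a) {Q g : ℝ → ℂ} (hQ : Continuous Q)
    (hQa : ∀ x, ‖Q x‖ ≤ a x) (hg : Continuous g) {M : ℝ} (hM : ∀ x, ‖g x‖ ≤ M) :
    Integrable (fun x => Q x * g x) := by
  refine Integrable.mono' (ha.mul_const M) (hQ.mul hg).aestronglyMeasurable ?_
  refine Eventually.of_forall fun x => ?_
  rw [norm_mul]
  exact mul_le_mul (hQa x) (hM x) (norm_nonneg _) ((norm_nonneg _).trans (hQa x))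

lemma It_props {a : ℝ → ℝ} (hac : Continuous a) (h0 : ∀ x, 0 ≤ a x) (ha : Integrable a) (k : ℕ) :
    ∀ Q1 Q2 : ℝ → ℂ, Continuous Q1 → Continuous Q2 → (∀ x, ‖Q1 x‖ ≤ a x) → (∀ x, ‖Q2 x‖ ≤ a x) →
    Continuous (It k Q1 Q2) ∧ ∀ x, ‖It k Q1 Q2 x‖ ≤ (∫ y in Ioi x, a y) ^ k / k.factorial := by
  induction k with
  | zero => 
    intro Q1 Q2 _ _ _ _
    refine ⟨?_, fun x => by simp [It]⟩
    show Continuous (fun _ => (1:ℂ))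
    fun_prop
  | succ k ih =>
    intro Q1 Q2 h1 h2 b1 b2
    obtain ⟨ic, ib⟩ := ih Q2 Q1 h2 h1 b2 b1
    have hM : ∀ x, ‖It k Q2 Q1 x‖ ≤ (∫ y, a y) ^ k / k.factorial := fun x =>
      (ib x).trans (div_le_div_of_nonneg_right (pow_le_pow_left₀ (tail_nonneg h0 x) (tail_le h0 ha x) k) (by positivity))
    have hint := integ_mul ha h1 b1 ic hM
    refine ⟨?_, fun x => ?_⟩
    · exact continuous_iff_continuousAt.2 fun x =>
        (tail_hasDerivAt (h1.mul ic) hint x).continuousAt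
    · set S : ℝ → ℝ := fun x => ∫ y in Ioi x, a y with hS
      have hSd : ∀ x, HasDerivAt S (-a x) x := tail_hasDerivAt hac ha
      have hSc : Continuous S := continuous_iff_continuousAt.2 fun x => (hSd x).continuousAt
      have hd : ∀ x, HasDerivAt (fun x => - (S x ^ (k+1) / (k+1).factorial))
          (a x * (S x ^ k / k.factorial)) x := by
        intro x
        have := (((hSd x).pow (k+1)).div_const ((k+1).factorial : ℝ)).neg
        refine HasDerivAt.congr_deriv this ?_
        rw [Nat.factorial_succ]
        push_cast
        have : (k.factorial : ℝ) ≠ 0 := by positivity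
        have : (k : ℝ) + 1 ≠ 0 := by positivity
        field_simp
      have hi : Integrable (fun x => a x * (S x ^ k / k.factorial)) := by
        refine Integrable.mono' (ha.mul_const ((∫ y, a y) ^ k / k.factorial))
          (hac.mul ((hSc.pow k).div_const _)).aestronglyMeasurable ?_
        refine Eventually.of_forall fun x => ?_
        have := tail_nonneg h0 x
        rw [Real.norm_of_nonneg (mul_nonneg (h0 x) (div_nonneg (pow_nonneg this _) (by positivity)))]
        have := tail_le h0 ha x
        have := h0 x
        gcongr
      have hlim : Tendsto (fun x => - (S x ^ (k+1) / (k+1).factorial)) atTop (nhds 0) := by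
        have := (((tail_tendsto_atTop (g := a)).pow (k+1)).div_const ((k+1).factorial : ℝ)).neg
        simpa using this
      have := integral_Ioi_of_hasDerivAt_of_tendsto (a := x) (hd x).continuousAt.continuousWithinAt
        (fun x _ => hd x) hi.integrableOn hlim
      have e : S x ^ (k+1) / (k+1).factorial = ∫ y in Ioi x, a y * (S y ^ k / k.factorial) := by
        rw [this]; ring
      show ‖∫ y in Ioi x, Q1 y * It k Q2 Q1 y‖ ≤ S x ^ (k+1) / (k+1).factorial
      rw [e]
      refine norm_integral_le_of_norm_le hi.integrableOn (Eventually.of_forall fun y => ?_)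
      rw [norm_mul]
      exact mul_le_mul (b1 y) (ib y) (norm_nonneg _) (h0 y)

lemma It_bd {a : ℝ → ℝ} (hac : Continuous a) (h0 : ∀ x, 0 ≤ a x) (ha : Integrable a) (k : ℕ)
    {Q1 Q2 : ℝ → ℂ} (h1 : Continuous Q1) (h2 : Continuous Q2) (b1 : ∀ x, ‖Q1 x‖ ≤ a x)
    (b2 : ∀ x, ‖Q2 x‖ ≤ a x) (x : ℝ) : ‖It k Q1 Q2 x‖ ≤ (∫ y, a y) ^ k / k.factorial :=
  ((It_props hac h0 ha k Q1 Q2 h1 h2 b1 b2).2 x).trans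
    (div_le_div_of_nonneg_right (pow_le_pow_left₀ (tail_nonneg h0 x) (tail_le h0 ha x) k) (by positivity))

/-- `Par f z Q1 Q2 x` sums the iterates over the indices in the range of `f`. -/
noncomputable def Par (f : ℕ → ℕ) (z : ℂ) (Q1 Q2 : ℝ → ℂ) (x : ℝ) : ℂ :=
  ∑' n : ℕ, It (f n) Q1 Q2 x * z ^ (f n)

lemma summable_par (f : ℕ → ℕ) (hf : Function.Injective f) (A r : ℝ) :
    Summable (fun n => A ^ (f n) / (f n).factorial * r ^ (f n)) := by
  have := (Real.summable_pow_div_factorial (A * r)).comp_injective hf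
  refine this.congr fun n => ?_
  simp only [Function.comp, mul_pow]
  ring

lemma term_bd {a : ℝ → ℝ} (hac : Continuous a) (h0 : ∀ x, 0 ≤ a x) (ha : Integrable a) (k : ℕ)
    {Q1 Q2 : ℝ → ℂ} (h1 : Continuous Q1) (h2 : Continuous Q2) (b1 : ∀ x, ‖Q1 x‖ ≤ a x)
    (b2 : ∀ x, ‖Q2 x‖ ≤ a x) (z : ℂ) (x : ℝ) :
    ‖It k Q1 Q2 x * z ^ k‖ ≤ (∫ y, a y) ^ k / k.factorial * ‖z‖ ^ k := by
  rw [norm_mul, norm_pow]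
  gcongr
  exact It_bd hac h0 ha k h1 h2 b1 b2 x

lemma Par_props {a : ℝ → ℝ} (hac : Continuous a) (h0 : ∀ x, 0 ≤ a x) (ha : Integrable a)
    (f : ℕ → ℕ) (hf : Function.Injective f)
    {Q1 Q2 : ℝ → ℂ} (h1 : Continuous Q1) (h2 : Continuous Q2) (b1 : ∀ x, ‖Q1 x‖ ≤ a x)
    (b2 : ∀ x, ‖Q2 x‖ ≤ a x) (z : ℂ) :
    Continuous (Par f z Q1 Q2) ∧ (∃ M, ∀ x, ‖Par f z Q1 Q2 x‖ ≤ M) ∧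
    Integrable (fun x => Q2 x * Par f z Q1 Q2 x) ∧
    ∀ s : Set ℝ, HasSum (fun n => (∫ y in s, Q2 y * It (f n) Q1 Q2 y) * z ^ (f n))
      (∫ y in s, Q2 y * Par f z Q1 Q2 y) := by
  have hs := summable_par f hf (∫ y, a y) ‖z‖
  have hc : Continuous (Par f z Q1 Q2) :=
    continuous_tsum (fun n => (It_props hac h0 ha (f n) Q1 Q2 h1 h2 b1 b2).1.mul continuous_const) hs
      (fun n x => term_bd hac h0 ha (f n) h1 h2 b1 b2 z x)
  have hM : ∀ x, ‖Par f z Q1 Q2 x‖ ≤ ∑' n, (∫ y, a y) ^ (f n) / (f n).factorial * ‖z‖ ^ (f n) :=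
    fun x => tsum_of_norm_bounded hs.hasSum (fun n => term_bd hac h0 ha (f n) h1 h2 b1 b2 z x)
  refine ⟨hc, ⟨_, hM⟩, integ_mul ha h2 b2 hc hM, fun s => ?_⟩
  have hint : ∀ n, Integrable (fun y => Q2 y * (It (f n) Q1 Q2 y * z ^ (f n))) := fun n =>
    integ_mul ha h2 b2 ((It_props hac h0 ha (f n) Q1 Q2 h1 h2 b1 b2).1.mul continuous_const)
      (fun x => term_bd hac h0 ha (f n) h1 h2 b1 b2 z x)
  have := hasSum_integral_of_summable_integral_norm (μ := volume.restrict s)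
    (F := fun n y => Q2 y * (It (f n) Q1 Q2 y * z ^ (f n))) (fun n => (hint n).integrableOn) ?_
  · have e1 : (fun n => (∫ y in s, Q2 y * It (f n) Q1 Q2 y) * z ^ (f n)) =
        fun n => ∫ y in s, Q2 y * (It (f n) Q1 Q2 y * z ^ (f n)) := by
      funext n
      rw [← integral_mul_const]
      simp only [mul_assoc]
    rw [e1]
    simp only [tsum_mul_left] at this
    exact this
  · refine Summable.of_nonneg_of_le (fun n => integral_nonneg fun _ => norm_nonneg _) (fun n => ?_)
      (hs.mul_left (∫ y, a y))
    rw [← integral_mul_const]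
    refine (setIntegral_le_integral (hint n).norm (Eventually.of_forall fun _ => norm_nonneg _)).trans ?_
    refine integral_mono (hint n).norm (ha.mul_const _) fun y => ?_
    show ‖Q2 y * _‖ ≤ _
    rw [norm_mul]
    exact mul_le_mul (b2 y) (term_bd hac h0 ha (f n) h1 h2 b1 b2 z y) (norm_nonneg _) (h0 y)

structure Hyp (a : ℝ → ℝ) (Q : ℝ → ℂ) : Prop where
  hac : Continuous a
  h0 : ∀ x, 0 ≤ a x
  ha : Integrable a
  hQ : Continuous Q
  hb : ∀ x, ‖Q x‖ ≤ a x

noncomputable def cj (Q : ℝ → ℂ) : ℝ → ℂ := fun x => (starRingEnd ℂ) (Q x)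

lemma Hyp.cQ {a : ℝ → ℝ} {Q : ℝ → ℂ} (H : Hyp a Q) : Continuous (cj Q) :=
  Complex.continuous_conj.comp H.hQ

lemma Hyp.cb {a : ℝ → ℝ} {Q : ℝ → ℂ} (H : Hyp a Q) (x : ℝ) : ‖cj Q x‖ ≤ a x := by
  simpa [cj] using H.hb x

noncomputable def al (Q : ℝ → ℂ) (z : ℂ) : ℝ → ℂ := Par (fun n => 2 * n) z Q (cj Q)
noncomputable def be (Q : ℝ → ℂ) (z : ℂ) : ℝ → ℂ := Par (fun n => 2 * n + 1) z (cj Q) Q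
noncomputable def fL (Q : ℝ → ℂ) (z : ℂ) : ℂ := 1 + z * ∫ x, Q x * be Q z x
noncomputable def gL (Q : ℝ → ℂ) (z : ℂ) : ℂ := z * ∫ x, cj Q x * al Q z x

lemma even_inj : Function.Injective (fun n : ℕ => 2 * n) := fun a b h => by simpa using h
lemma odd_inj : Function.Injective (fun n : ℕ => 2 * n + 1) := fun a b h => by simpa using h

section
variable {a : ℝ → ℝ} {Q : ℝ → ℂ}

lemma al_props (H : Hyp a Q) (z : ℂ) :
    Continuous (al Q z) ∧ (∃ M, ∀ x, ‖al Q z x‖ ≤ M) ∧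
    Integrable (fun x => cj Q x * al Q z x) ∧
    ∀ s : Set ℝ, HasSum (fun n : ℕ => (∫ y in s, cj Q y * It (2 * n) Q (cj Q) y) * z ^ (2 * n))
      (∫ y in s, cj Q y * al Q z y) :=
  Par_props H.hac H.h0 H.ha _ even_inj H.hQ H.cQ H.hb H.cb z

lemma be_props (H : Hyp a Q) (z : ℂ) :
    Continuous (be Q z) ∧ (∃ M, ∀ x, ‖be Q z x‖ ≤ M) ∧
    Integrable (fun x => Q x * be Q z x) ∧
    ∀ s : Set ℝ, HasSum (fun n : ℕ => (∫ y in s, Q y * It (2 * n + 1) (cj Q) Q y) * z ^ (2 * n + 1))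
      (∫ y in s, Q y * be Q z y) :=
  Par_props H.hac H.h0 H.ha _ odd_inj H.cQ H.hQ H.cb H.hb z

lemma al_eq (H : Hyp a Q) (z : ℂ) (x : ℝ) : al Q z x = 1 + z * ∫ y in Ioi x, Q y * be Q z y := by
  have h := ((be_props H z).2.2.2 (Ioi x)).mul_left z
  have h2 : HasSum (fun n : ℕ => It (2 * (n + 1)) Q (cj Q) x * z ^ (2 * (n + 1)))
      (z * ∫ y in Ioi x, Q y * be Q z y) := by
    refine h.congr_fun ?_
    intro n
    show (∫ y in Ioi x, Q y * It (2 * n + 1) (cj Q) Q y) * z ^ (2 * (n + 1)) = _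
    ring
  have h3 := (hasSum_nat_add_iff (f := fun n : ℕ => It (2 * n) Q (cj Q) x * z ^ (2 * n)) 1).1 h2
  have h4 := h3.tsum_eq
  show (∑' n : ℕ, It (2 * n) Q (cj Q) x * z ^ (2 * n)) = _
  rw [h4]
  simp [It, add_comm]

lemma be_eq (H : Hyp a Q) (z : ℂ) (x : ℝ) : be Q z x = z * ∫ y in Ioi x, cj Q y * al Q z y := by
  have h := ((al_props H z).2.2.2 (Ioi x)).mul_left z
  have h2 : HasSum (fun n : ℕ => It (2 * n + 1) (cj Q) Q x * z ^ (2 * n + 1))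
      (z * ∫ y in Ioi x, cj Q y * al Q z y) := by
    refine h.congr_fun ?_
    intro n
    show (∫ y in Ioi x, cj Q y * It (2 * n) Q (cj Q) y) * z ^ (2 * n + 1) = _
    ring
  exact h2.tsum_eq

lemma al_deriv (H : Hyp a Q) (z : ℂ) (x : ℝ) : HasDerivAt (al Q z) (-(z * (Q x * be Q z x))) x := by
  have e : al Q z = fun x => 1 + z * ∫ y in Ioi x, Q y * be Q z y := funext (al_eq H z)
  have p := be_props H z
  have := ((tail_hasDerivAt (g := fun y => Q y * be Q z y) (H.hQ.mul p.1) p.2.2.1 x).const_mul z).const_add 1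
  rw [← mul_neg, e]
  exact this

lemma be_deriv (H : Hyp a Q) (z : ℂ) (x : ℝ) : HasDerivAt (be Q z) (-(z * (cj Q x * al Q z x))) x := by
  have e : be Q z = fun x => z * ∫ y in Ioi x, cj Q y * al Q z y := funext (be_eq H z)
  have p := al_props H z
  have := ((tail_hasDerivAt (g := fun y => cj Q y * al Q z y) (H.cQ.mul p.1) p.2.2.1 x).const_mul z)
  rw [← mul_neg, e]
  exact this

lemma al_top (H : Hyp a Q) (z : ℂ) : Tendsto (al Q z) atTop (nhds 1) := by
  have e : al Q z = fun x => 1 + z * ∫ y in Ioi x, Q y * be Q z y := funext (al_eq H z)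
  rw [e]
  simpa using ((tail_tendsto_atTop (g := fun y => Q y * be Q z y)).const_mul z).const_add 1

lemma be_top (H : Hyp a Q) (z : ℂ) : Tendsto (be Q z) atTop (nhds 0) := by
  have e : be Q z = fun x => z * ∫ y in Ioi x, cj Q y * al Q z y := funext (be_eq H z)
  rw [e]
  simpa using ((tail_tendsto_atTop (g := fun y => cj Q y * al Q z y)).const_mul z)

lemma al_bot (H : Hyp a Q) (z : ℂ) : Tendsto (al Q z) atBot (nhds (fL Q z)) := by
  have e : al Q z = fun x => 1 + z * ∫ y in Ioi x, Q y * be Q z y := funext (al_eq H z)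
  have p := be_props H z
  have := ((tail_tendsto_atBot p.2.2.1).const_mul z).const_add 1
  rw [← e] at this
  exact this

lemma be_bot (H : Hyp a Q) (z : ℂ) : Tendsto (be Q z) atBot (nhds (gL Q z)) := by
  have e : be Q z = fun x => z * ∫ y in Ioi x, cj Q y * al Q z y := funext (be_eq H z)
  have p := al_props H z
  have := ((tail_tendsto_atBot p.2.2.1).const_mul z)
  rw [← e] at this
  exact this

lemma fL_diff (H : Hyp a Q) : Differentiable ℂ (fL Q) := by
  have e : fL Q = fun z => 1 + z * ∑' n : ℕ,
      (∫ y, Q y * It (2 * n + 1) (cj Q) Q y) * z ^ (2 * n + 1) := by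
    funext z
    have := ((be_props H z).2.2.2 univ).tsum_eq
    simp only [setIntegral_univ] at this
    rw [this, fL]
  rw [e]
  suffices h : Differentiable ℂ (fun z : ℂ => ∑' n : ℕ,
      (∫ y, Q y * It (2 * n + 1) (cj Q) Q y) * z ^ (2 * n + 1)) by fun_prop
  intro w
  have hs := (summable_par (fun n => 2 * n + 1) odd_inj (∫ y, a y) (‖w‖ + 1)).mul_left (∫ y, a y)
  have := Complex.differentiableOn_tsum_of_summable_norm (U := Metric.ball 0 (‖w‖ + 1))
    (F := fun (n : ℕ) (z : ℂ) => (∫ y, Q y * It (2 * n + 1) (cj Q) Q y) * z ^ (2 * n + 1)) hs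
    (fun n => by fun_prop) Metric.isOpen_ball ?_
  · exact this.differentiableAt (Metric.isOpen_ball.mem_nhds (by simp))
  · intro n z hz
    have hz' : ‖z‖ ≤ ‖w‖ + 1 := by simpa using (Metric.mem_ball.1 hz).le
    rw [norm_mul, norm_pow, ← mul_assoc]
    have hA : 0 ≤ ∫ y, a y := integral_nonneg H.h0
    gcongr
    rw [← integral_mul_const]
    refine norm_integral_le_of_norm_le (H.ha.mul_const _) (Eventually.of_forall fun y => ?_)
    rw [norm_mul]
    exact mul_le_mul (H.hb y) (It_bd H.hac H.h0 H.ha _ H.cQ H.hQ H.cb H.hb y) (norm_nonneg _) (H.h0 y)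

lemma energy (H : Hyp a Q) (z : ℂ) (hz : 0 ≤ z.re) (x : ℝ) :
    ‖al Q z x‖ ^ 2 + ‖be Q z x‖ ^ 2 ≤ Real.exp (2 * z.re * ∫ y in Ioi x, a y) := by
  set S : ℝ → ℝ := fun x => ∫ y in Ioi x, a y with hS
  have hSd : ∀ x, HasDerivAt S (-a x) x := tail_hasDerivAt H.hac H.ha
  have hd : ∀ x, HasDerivAt (fun x => (‖al Q z x‖ ^ 2 + ‖be Q z x‖ ^ 2) * Real.exp (-(2 * z.re * S x)))
      ((2 * inner ℝ (al Q z x) (-(z * (Q x * be Q z x))) +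
        2 * inner ℝ (be Q z x) (-(z * (cj Q x * al Q z x)))) * Real.exp (-(2 * z.re * S x)) +
        (‖al Q z x‖ ^ 2 + ‖be Q z x‖ ^ 2) * (Real.exp (-(2 * z.re * S x)) * (-(2 * z.re * -a x)))) x :=
    fun x => ((al_deriv H z x).norm_sq.add (be_deriv H z x).norm_sq).mul
      (((hSd x).const_mul (2 * z.re)).neg.exp)
  have hmono : Monotone (fun x => (‖al Q z x‖ ^ 2 + ‖be Q z x‖ ^ 2) * Real.exp (-(2 * z.re * S x))) := by
    refine monotone_of_deriv_nonneg (fun x => (hd x).differentiableAt) fun x => ?_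
    rw [(hd x).deriv]
    have key : 2 * inner ℝ (al Q z x) (-(z * (Q x * be Q z x))) +
        2 * inner ℝ (be Q z x) (-(z * (cj Q x * al Q z x))) =
        -(4 * z.re * ((starRingEnd ℂ) (al Q z x) * (Q x * be Q z x)).re) := by
      simp only [Complex.inner, cj, Complex.mul_re, Complex.neg_re, Complex.neg_im, Complex.mul_im,
        Complex.conj_re, Complex.conj_im]
      ring
    have b1 : ((starRingEnd ℂ) (al Q z x) * (Q x * be Q z x)).re ≤ ‖al Q z x‖ * (a x * ‖be Q z x‖) := by
      refine (Complex.re_le_norm _).trans ?_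
      rw [norm_mul, norm_mul, RCLike.norm_conj]
      gcongr
      exact H.hb x
    have b2 : ‖al Q z x‖ * (a x * ‖be Q z x‖) * 2 ≤ a x * (‖al Q z x‖ ^ 2 + ‖be Q z x‖ ^ 2) := by
      nlinarith [mul_nonneg (H.h0 x) (sq_nonneg (‖al Q z x‖ - ‖be Q z x‖))]
    rw [key]
    have b3 : 0 ≤ z.re * (a x * (‖al Q z x‖ ^ 2 + ‖be Q z x‖ ^ 2) -
        2 * ((starRingEnd ℂ) (al Q z x) * (Q x * be Q z x)).re) := mul_nonneg hz (by linarith)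
    have := mul_nonneg b3 (Real.exp_pos (-(2 * z.re * S x))).le
    nlinarith
  have hlim : Tendsto (fun x => (‖al Q z x‖ ^ 2 + ‖be Q z x‖ ^ 2) * Real.exp (-(2 * z.re * S x)))
      atTop (nhds 1) := by
    have h1 := ((al_top H z).norm.pow 2).add ((be_top H z).norm.pow 2)
    have h2 : Tendsto (fun x => Real.exp (-(2 * z.re * S x))) atTop (nhds (Real.exp (-(2 * z.re * 0)))) :=
      (Real.continuous_exp.tendsto _).comp (((tail_tendsto_atTop (g := a)).const_mul (2 * z.re)).neg)
    simpa using h1.mul h2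
  have := hmono.ge_of_tendsto hlim x
  rw [Real.exp_neg, ← div_eq_mul_inv, div_le_one (Real.exp_pos _)] at this
  exact this

lemma fL_le (H : Hyp a Q) (z : ℂ) (hz : 0 ≤ z.re) : ‖fL Q z‖ ≤ Real.exp (z.re * ∫ y, a y) := by
  refine le_of_tendsto (al_bot H z).norm (Eventually.of_forall fun x => ?_)
  have h1 := energy H z hz x
  have h2 : Real.exp (2 * z.re * ∫ y in Ioi x, a y) ≤ (Real.exp (z.re * ∫ y, a y)) ^ 2 := by
    rw [← Real.exp_nat_mul]
    refine Real.exp_le_exp.2 ?_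
    have := mul_le_mul_of_nonneg_left (tail_le H.h0 H.ha x) hz
    push_cast
    linarith
  refine abs_le_of_sq_le_sq' ?_ (Real.exp_pos _).le |>.2
  have := sq_nonneg ‖be Q z x‖
  linarith

lemma conserv (H : Hyp a Q) (t : ℝ) (x : ℝ) : ‖al Q t x‖ ^ 2 - ‖be Q t x‖ ^ 2 = 1 := by
  have hd : ∀ x, HasDerivAt (fun x => ‖al Q t x‖ ^ 2 - ‖be Q t x‖ ^ 2) 0 x := by
    intro x
    refine ((al_deriv H t x).norm_sq.sub (be_deriv H t x).norm_sq).congr_deriv ?_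
    simp only [Complex.inner, cj, Complex.mul_re, Complex.neg_re, Complex.neg_im, Complex.mul_im,
        Complex.conj_re, Complex.conj_im, Complex.ofReal_re, Complex.ofReal_im]
    ring
  have hc := is_const_of_deriv_eq_zero (fun x => (hd x).differentiableAt) (fun x => (hd x).deriv)
  have hlim : Tendsto (fun x => ‖al Q t x‖ ^ 2 - ‖be Q t x‖ ^ 2) atTop (nhds 1) := by
    simpa using ((al_top H (t:ℂ)).norm.pow 2).sub ((be_top H (t:ℂ)).norm.pow 2)
  have e : (fun y => ‖al Q t y‖ ^ 2 - ‖be Q t y‖ ^ 2) = fun _ => ‖al Q t x‖ ^ 2 - ‖be Q t x‖ ^ 2 :=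
    funext fun y => hc y x
  rw [e] at hlim
  exact tendsto_nhds_unique tendsto_const_nhds hlim

lemma conservL (H : Hyp a Q) (t : ℝ) : ‖fL Q t‖ ^ 2 - ‖gL Q t‖ ^ 2 = 1 := by
  refine tendsto_nhds_unique (((al_bot H (t:ℂ)).norm.pow 2).sub ((be_bot H (t:ℂ)).norm.pow 2)) ?_
  simp only [conserv H]
  exact tendsto_const_nhds

end
lemma quad_ineq {X Y n ta D B θ : ℝ} (hn : n ^ 2 = X ^ 2 + Y ^ 2) (hn0 : 0 ≤ n) (hB : |θ| ≤ B)
    (h1 : B ^ 2 ≤ ta * D) (h2 : D ≤ ta) (h3 : 0 ≤ D) :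
    2 * θ * Y - 2 * ta * n ≤ -(2 * (ta - D) * X) := by
  have hX1 : X ≤ n := abs_le_of_sq_le_sq' (by nlinarith [sq_nonneg Y]) hn0 |>.2
  have hX2 : -n ≤ X := abs_le_of_sq_le_sq' (by nlinarith [sq_nonneg Y]) hn0 |>.1
  have hB0 : 0 ≤ B := (abs_nonneg _).trans hB
  have hY : θ * Y ≤ B * |Y| := by
    refine (le_abs_self _).trans ?_
    rw [abs_mul]
    gcongr
  set R := (ta - D / 2) * (n - X) + D / 2 * (n + X) with hR
  have hR0 : 0 ≤ R := add_nonneg (mul_nonneg (by linarith) (by linarith))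
    (mul_nonneg (by linarith) (by linarith))
  have hsq : (B * |Y|) ^ 2 ≤ R ^ 2 := by
    rw [mul_pow, sq_abs]
    have hYY : Y ^ 2 = (n - X) * (n + X) := by nlinarith
    have e1 : 4 * ((ta - D / 2) * (n - X)) * (D / 2 * (n + X)) ≤ R ^ 2 := by
      nlinarith [sq_nonneg ((ta - D / 2) * (n - X) - D / 2 * (n + X))]
    have e2 : B ^ 2 ≤ 4 * (ta - D / 2) * (D / 2) := by nlinarith
    have e3 := mul_le_mul_of_nonneg_right e2 (sq_nonneg Y)
    rw [hYY] at e3 ⊢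
    nlinarith
  have := abs_le_of_sq_le_sq' hsq hR0 |>.2
  nlinarith

lemma lower {a Φ θ : ℝ → ℝ} {Q : ℝ → ℂ} (H : Hyp a Q)
    (hQ : ∀ x, Q x = (a x : ℂ) * Complex.exp (2 * Complex.I * (Φ x : ℂ)))
    (hΦ : ∀ x, HasDerivAt Φ (θ x) x) {B : ℝ} (hB : ∀ x, |θ x| ≤ B)
    {t : ℝ} (ht : 0 < t) {xm xp : ℝ} (hx : xm ≤ xp) {D D' : ℝ → ℝ}
    (hD : ∀ x, HasDerivAt D (D' x) x) (hD0 : ∀ x, 0 ≤ D' x)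
    (hD1 : ∀ x ∈ Icc xm xp, B ^ 2 ≤ t * a x * D' x)
    (hD2 : ∀ x ∈ Icc xm xp, D' x ≤ t * a x) :
    Real.exp (t * (∫ y, a y) - 2 * t * ((∫ y, a y) - ∫ y in Ioi xm, a y)
      - 2 * t * (∫ y in Ioi xp, a y) - (D xp - D xm)) ≤ 4 * ‖fL Q t‖ := by
  set S : ℝ → ℝ := fun x => ∫ y in Ioi x, a y with hS
  set A := ∫ y, a y with hA
  have hSd : ∀ x, HasDerivAt S (-a x) x := tail_hasDerivAt H.hac H.ha
  have hSA : ∀ x, S x ≤ A := tail_le H.h0 H.ha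
  set v0 : ℂ := Complex.exp (Complex.I * (Φ xp : ℂ)) with hv0
  have hv0n : ‖v0‖ = 1 := by rw [hv0, mul_comm]; exact Complex.norm_exp_ofReal_mul_I _
  set ζ : ℂ := (starRingEnd ℂ) (al Q t xp) * v0 - (starRingEnd ℂ) (be Q t xp) * (starRingEnd ℂ) v0 with hζ
  set v : ℝ → ℂ := fun x => al Q t x * ζ + (starRingEnd ℂ) (be Q t x) * (starRingEnd ℂ) ζ with hv
  have hen : ∀ x, ‖al Q t x‖ ≤ Real.exp (t * S x) ∧ ‖be Q t x‖ ≤ Real.exp (t * S x) := by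
    intro x
    have h1 := energy H (t : ℂ) (by simpa using ht.le) x
    have h2 : Real.exp (2 * (t:ℂ).re * ∫ y in Ioi x, a y) = (Real.exp (t * S x)) ^ 2 := by
      rw [← Real.exp_nat_mul]
      simp [hS, mul_assoc]
    rw [h2] at h1
    constructor <;> refine abs_le_of_sq_le_sq' ?_ (Real.exp_pos _).le |>.2 <;>
      nlinarith [sq_nonneg ‖be Q t x‖, sq_nonneg ‖al Q t x‖]
  have hζn : ‖ζ‖ ≤ 2 * Real.exp (t * S xp) := by
    refine (norm_sub_le _ _).trans ?_
    rw [norm_mul, norm_mul, RCLike.norm_conj, RCLike.norm_conj, RCLike.norm_conj, hv0n]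
    linarith [(hen xp).1, (hen xp).2]
  have hvxp : v xp = v0 := by
    have hc := conserv H t xp
    have e1 : al Q t xp * (starRingEnd ℂ) (al Q t xp) - be Q t xp * (starRingEnd ℂ) (be Q t xp) = 1 := by
      rw [Complex.mul_conj, Complex.mul_conj, Complex.normSq_eq_norm_sq, Complex.normSq_eq_norm_sq]
      exact_mod_cast hc
    simp only [hv, hζ, map_sub, map_mul, Complex.conj_conj]
    linear_combination v0 * e1
  have hvd : ∀ x, HasDerivAt v (-(t * (Q x * (starRingEnd ℂ) (v x)))) x := by
    intro x
    have h2 : HasDerivAt (fun x => (starRingEnd ℂ) (be Q t x))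
      ((starRingEnd ℂ) (-(t * (cj Q x * al Q t x)))) x := (be_deriv H (t:ℂ) x).star
    refine (((al_deriv H (t:ℂ) x).mul_const ζ).add (h2.mul_const ((starRingEnd ℂ) ζ))).congr_deriv ?_
    simp only [hv, cj, map_add, map_mul, map_neg, Complex.conj_conj, Complex.conj_ofReal]
    ring
  -- far left region
  have hleft : ∀ x ≤ xm, ‖v xm‖ ^ 2 * Real.exp (2 * t * S xm) ≤ ‖v x‖ ^ 2 * Real.exp (2 * t * S x) := by
    have hd : ∀ x, HasDerivAt (fun x => ‖v x‖ ^ 2 * Real.exp (2 * t * S x))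
      ((2 * inner ℝ (v x) (-(t * (Q x * (starRingEnd ℂ) (v x))))) * Real.exp (2 * t * S x) +
        ‖v x‖ ^ 2 * (Real.exp (2 * t * S x) * (2 * t * -a x))) x := fun x =>
      (hvd x).norm_sq.mul (((hSd x).const_mul (2 * t)).exp)
    have hanti : Antitone (fun x => ‖v x‖ ^ 2 * Real.exp (2 * t * S x)) := by
      refine antitone_of_deriv_nonpos (fun x => (hd x).differentiableAt) fun x => ?_
      rw [(hd x).deriv]
      have b1 : inner ℝ (v x) (-(t * (Q x * (starRingEnd ℂ) (v x)))) ≤ t * a x * ‖v x‖ ^ 2 := by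
        refine (real_inner_le_norm _ _).trans ?_
        rw [norm_neg, norm_mul, norm_mul, RCLike.norm_conj, Complex.norm_real, Real.norm_of_nonneg ht.le]
        have : ‖v x‖ * (t * (‖Q x‖ * ‖v x‖)) = t * ‖Q x‖ * ‖v x‖ ^ 2 := by ring
        rw [this]
        gcongr
        exact H.hb x
      have := mul_le_mul_of_nonneg_right b1 (Real.exp_pos (2 * t * S x)).le
      nlinarith
    intro x hxx
    exact hanti hxx
  -- middle region
  set g : ℝ → ℂ := fun x => Complex.exp (-(2 * Complex.I * (Φ x : ℂ))) * (v x) ^ 2 with hg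
  have hgd : ∀ x, HasDerivAt g (-(2 * Complex.I * (θ x : ℂ)) * g x - 2 * t * a x * (‖v x‖ ^ 2 : ℝ)) x := by
    intro x
    have h1 : HasDerivAt (fun x => (Φ x : ℂ)) (θ x : ℂ) x := (hΦ x).ofReal_comp
    have h2 := ((h1.const_mul (2 * Complex.I)).neg.cexp).mul ((hvd x).pow 2)
    refine h2.congr_deriv ?_
    rw [hQ x, ← Complex.normSq_eq_norm_sq, ← Complex.mul_conj]
    have e : Complex.exp (-(2 * Complex.I * (Φ x : ℂ))) * Complex.exp (2 * Complex.I * (Φ x : ℂ)) = 1 := by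
      rw [← Complex.exp_add]; simp
    simp only [hg, Pi.pow_apply, Pi.neg_apply]
    push_cast
    linear_combination (-2 * t * a x * v x * (starRingEnd ℂ) (v x)) * e
  have hgn : ∀ x, ‖g x‖ = ‖v x‖ ^ 2 := by
    intro x
    have : ‖Complex.exp (-(2 * Complex.I * (Φ x : ℂ)))‖ = 1 := by
      have e : -(2 * Complex.I * (Φ x : ℂ)) = ((-(2 * Φ x) : ℝ) : ℂ) * Complex.I := by push_cast; ring
      rw [e]; exact Complex.norm_exp_ofReal_mul_I _
    rw [hg]
    simp [this]
  have hgr : ∀ x, HasDerivAt (fun x => (g x).re)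
      (2 * θ x * (g x).im - 2 * (t * a x) * ‖v x‖ ^ 2) x := by
    intro x
    have := Complex.reCLM.hasFDerivAt.comp_hasDerivAt x (hgd x)
    refine HasDerivAt.congr_deriv this ?_
    simp [-Complex.ofReal_pow, Complex.mul_re, Complex.mul_im]
    left
    ring
  have hmid : (g xp).re * Real.exp (-(2 * t * S xp) - 2 * D xp) ≤
      (g xm).re * Real.exp (-(2 * t * S xm) - 2 * D xm) := by
    have hd : ∀ x, HasDerivAt (fun x => (g x).re * Real.exp (-(2 * t * S x) - 2 * D x))
      ((2 * θ x * (g x).im - 2 * (t * a x) * ‖v x‖ ^ 2) * Real.exp (-(2 * t * S x) - 2 * D x) +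
        (g x).re * (Real.exp (-(2 * t * S x) - 2 * D x) * (-(2 * t * -a x) - 2 * D' x))) x := fun x =>
      (hgr x).mul ((((hSd x).const_mul (2 * t)).neg.sub ((hD x).const_mul 2)).exp)
    have hanti : AntitoneOn (fun x => (g x).re * Real.exp (-(2 * t * S x) - 2 * D x)) (Icc xm xp) := by
      refine antitoneOn_of_deriv_nonpos (convex_Icc _ _)
        (fun x _ => (hd x).continuousAt.continuousWithinAt)
        (fun x _ => (hd x).differentiableAt.differentiableWithinAt) fun x hxi => ?_
      have hxi := interior_subset hxi
      rw [(hd x).deriv]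
      have hq := quad_ineq (X := (g x).re) (Y := (g x).im) (n := ‖v x‖ ^ 2) (θ := θ x)
        (by rw [← hgn, ← Complex.normSq_eq_norm_sq, Complex.normSq_apply]; ring) (by positivity) (hB x)
        (hD1 x hxi) (hD2 x hxi) (hD0 x)
      have := mul_le_mul_of_nonneg_right hq (Real.exp_pos (-(2 * t * S x) - 2 * D x)).le
      nlinarith
    exact hanti (left_mem_Icc.2 hx) (right_mem_Icc.2 hx) hx
  have hgxp : g xp = 1 := by
    simp only [hg, hvxp, hv0, ← Complex.exp_nat_mul, ← Complex.exp_add]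
    rw [← Complex.exp_zero]
    congr 1
    push_cast
    ring
  rw [hgxp, Complex.one_re, one_mul] at hmid
  have hvm : Real.exp (-(2 * t * S xp) - 2 * D xp) ≤ ‖v xm‖ ^ 2 * Real.exp (-(2 * t * S xm) - 2 * D xm) := by
    refine hmid.trans ?_
    gcongr
    rw [← hgn]
    exact Complex.re_le_norm _
  have hfin : ∀ x ≤ xm, Real.exp (t * A - 2 * t * (A - S xm) - 2 * t * S xp - (D xp - D xm)) ≤
      4 * ‖al Q t x‖ := by
    intro x hxx
    have h1 := hleft x hxx
    have h2 : (Real.exp (t * (2 * S xm - S xp - A) - (D xp - D xm))) ^ 2 ≤ ‖v x‖ ^ 2 := by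
      have e1 : (Real.exp (t * (2 * S xm - S xp - A) - (D xp - D xm))) ^ 2 =
          Real.exp (-(2 * t * S xp) - 2 * D xp) *
            Real.exp (4 * t * S xm + 2 * D xm - 2 * t * A) := by
        rw [← Real.exp_nat_mul, ← Real.exp_add]
        congr 1
        push_cast
        ring
      have e2 : ‖v xm‖ ^ 2 * Real.exp (-(2 * t * S xm) - 2 * D xm) *
          Real.exp (4 * t * S xm + 2 * D xm - 2 * t * A) =
          ‖v xm‖ ^ 2 * Real.exp (2 * t * S xm) * Real.exp (-(2 * t * A)) := by
        have e3 : Real.exp (-(2 * t * S xm) - 2 * D xm) *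
            Real.exp (4 * t * S xm + 2 * D xm - 2 * t * A) =
            Real.exp (2 * t * S xm) * Real.exp (-(2 * t * A)) := by
          rw [← Real.exp_add, ← Real.exp_add]
          congr 1
          ring
        rw [mul_assoc, e3, ← mul_assoc]
      rw [e1]
      refine (mul_le_mul_of_nonneg_right hvm (Real.exp_pos _).le).trans ?_
      rw [e2]
      refine (mul_le_mul_of_nonneg_right h1 (Real.exp_pos _).le).trans ?_
      rw [mul_assoc, ← Real.exp_add]
      refine mul_le_of_le_one_right (by positivity) (Real.exp_le_one_iff.2 ?_)
      have := mul_le_mul_of_nonneg_left (hSA x) ht.le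
      linarith
    have h3 := abs_le_of_sq_le_sq' h2 (norm_nonneg _) |>.2
    have hba : ‖be Q t x‖ ≤ ‖al Q t x‖ :=
      abs_le_of_sq_le_sq' (by linarith [conserv H t x]) (norm_nonneg _) |>.2
    have h4 : ‖v x‖ ≤ 2 * ‖al Q t x‖ * (2 * Real.exp (t * S xp)) := by
      refine (norm_add_le _ _).trans ?_
      rw [norm_mul, norm_mul, RCLike.norm_conj, RCLike.norm_conj, ← add_mul]
      gcongr
      linarith
    have e3 : Real.exp (t * A - 2 * t * (A - S xm) - 2 * t * S xp - (D xp - D xm)) =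
        Real.exp (t * (2 * S xm - S xp - A) - (D xp - D xm)) * Real.exp (-(t * S xp)) := by
      rw [← Real.exp_add]
      congr 1
      ring
    rw [e3]
    refine (mul_le_mul_of_nonneg_right (h3.trans h4) (Real.exp_pos _).le).trans (le_of_eq ?_)
    rw [Real.exp_neg]
    have := (Real.exp_pos (t * S xp)).ne'
    field_simp
    ring
  refine ge_of_tendsto ((al_bot H (t:ℂ)).norm.const_mul 4) ?_
  filter_upwards [eventually_le_atBot xm] with x hxx
  exact hfin x hxx
lemma lower_exp {a Φ θ : ℝ → ℝ} {Q : ℝ → ℂ} (H : Hyp a Q)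
    (hQ : ∀ x, Q x = (a x : ℂ) * Complex.exp (2 * Complex.I * (Φ x : ℂ)))
    (hΦ : ∀ x, HasDerivAt Φ (θ x) x) {B : ℝ} (hB0 : 0 < B) (hB : ∀ x, |θ x| ≤ B)
    {km kp c1 c2 : ℝ} (hkm : 0 < km) (hkp : kp < 0) (hc1 : 0 < c1)
    (hlow : ∀ x, c1 ≤ a x * (Real.exp (-(km * x)) + Real.exp (-(kp * x))))
    (hm : ∀ᶠ x in atBot, (∫ y, a y) - (∫ y in Ioi x, a y) ≤ c2 * Real.exp (km * x))
    (hp : ∀ᶠ x in atTop, (∫ y in Ioi x, a y) ≤ c2 * Real.exp (kp * x)) :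
    ∃ δ > 0, ∀ᶠ t : ℝ in atTop, δ * Real.exp (t * ∫ y, a y) ≤ ‖fL Q t‖ := by
  set L := 2 * B / c1 with hL
  have hL0 : 0 < L := by positivity
  set E := B ^ 2 / (c1 * L) * (1 / km - 1 / kp) with hE
  refine ⟨Real.exp (-(4 * c2 * L) - E) / 4, by positivity, ?_⟩
  have tl : Tendsto (fun t : ℝ => Real.log (t / L)) atTop atTop :=
    Real.tendsto_log_atTop.comp (tendsto_id.atTop_div_const hL0)
  have tm : Tendsto (fun t : ℝ => -(Real.log (t / L) / km)) atTop atBot :=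
    tendsto_neg_atTop_atBot.comp (tl.atTop_div_const hkm)
  have tp : Tendsto (fun t : ℝ => Real.log (t / L) / (-kp)) atTop atTop :=
    tl.atTop_div_const (by linarith)
  filter_upwards [tm.eventually hm, tp.eventually hp, tm.eventually (eventually_le_atBot 0),
    tp.eventually (eventually_ge_atTop 0), eventually_gt_atTop 0] with t h1 h2 h3 h4 ht
  set xm := -(Real.log (t / L) / km) with hxm
  set xp := Real.log (t / L) / (-kp) with hxp
  have htL : 0 < t / L := by positivity
  have em : km * xm = - Real.log (t / L) := by rw [hxm]; field_simp
  have ep : kp * xp = - Real.log (t / L) := by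
    have hne := hkp.ne
    rw [hxp]; field_simp
  have xm1 : Real.exp (km * xm) = L / t := by rw [em, Real.exp_neg, Real.exp_log htL, inv_div]
  have xm2 : Real.exp (-(km * xm)) = t / L := by rw [em, neg_neg, Real.exp_log htL]
  have xp1 : Real.exp (kp * xp) = L / t := by rw [ep, Real.exp_neg, Real.exp_log htL, inv_div]
  have xp2 : Real.exp (-(kp * xp)) = t / L := by rw [ep, neg_neg, Real.exp_log htL]
  have hBtc : 0 < B ^ 2 / (t * c1) := by positivity
  have key := lower H hQ hΦ hB ht (h3.trans h4)
    (D := fun x => B ^ 2 / (t * c1) * (-(Real.exp (-(km * x)) / km) - Real.exp (-(kp * x)) / kp))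
    (D' := fun x => B ^ 2 / (t * c1) * (Real.exp (-(km * x)) + Real.exp (-(kp * x))))
    (fun x => by
      have d1 : HasDerivAt (fun x => Real.exp (-(km * x))) (Real.exp (-(km * x)) * (-(km * 1))) x :=
        (((hasDerivAt_id x).const_mul km).neg).exp
      have d2 : HasDerivAt (fun x => Real.exp (-(kp * x))) (Real.exp (-(kp * x)) * (-(kp * 1))) x :=
        (((hasDerivAt_id x).const_mul kp).neg).exp
      refine (((d1.div_const km).neg.sub (d2.div_const kp)).const_mul (B ^ 2 / (t * c1))).congr_deriv ?_
      have := hkm.ne'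
      have := hkp.ne
      field_simp
      try ring)
    (fun x => by positivity)
    (fun x _ => by
      have : t * a x * (B ^ 2 / (t * c1) * (Real.exp (-(km * x)) + Real.exp (-(kp * x)))) =
        B ^ 2 / c1 * (a x * (Real.exp (-(km * x)) + Real.exp (-(kp * x)))) := by
          field_simp
      rw [this]
      calc B ^ 2 = B ^ 2 / c1 * c1 := by field_simp
        _ ≤ _ := by gcongr; exact hlow x)
    (fun x hx => by
      have b1 : Real.exp (-(km * x)) ≤ t / L := by
        rw [← xm2]
        exact Real.exp_le_exp.2 (by nlinarith [hx.1])
      have b2 : Real.exp (-(kp * x)) ≤ t / L := by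
        rw [← xp2]
        exact Real.exp_le_exp.2 (by nlinarith [hx.2])
      have hmm := hlow x
      have hmpos : 0 < Real.exp (-(km * x)) + Real.exp (-(kp * x)) := by positivity
      have b3 : Real.exp (-(km * x)) + Real.exp (-(kp * x)) ≤ t * c1 / B := by
        have : t * c1 / B = 2 * (t / L) := by rw [hL]; field_simp
        linarith
      generalize Real.exp (-(km * x)) + Real.exp (-(kp * x)) = m at *
      have b4 : B * m ≤ t * c1 := by
        rw [le_div_iff₀ hB0] at b3; linarith
      have b5 : (B * m) ^ 2 ≤ (t * c1) ^ 2 := by gcongr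
      have b6 : t ^ 2 * c1 * c1 ≤ t ^ 2 * c1 * (a x * m) := by gcongr
      have b7 : B ^ 2 * m ≤ t * a x * (t * c1) := by
        refine le_of_mul_le_mul_right ?_ hmpos
        nlinarith
      rw [div_mul_eq_mul_div, div_le_iff₀ (by positivity)]
      exact b7)
  have hDb : (B ^ 2 / (t * c1) * (-(Real.exp (-(km * xp)) / km) - Real.exp (-(kp * xp)) / kp)) -
      (B ^ 2 / (t * c1) * (-(Real.exp (-(km * xm)) / km) - Real.exp (-(kp * xm)) / kp)) ≤ E := by
    have e : E = B ^ 2 / (t * c1) * (Real.exp (-(km * xm)) / km - Real.exp (-(kp * xp)) / kp) := by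
      rw [xm2, xp2, hE]
      have := hkm.ne'
      have := hkp.ne
      field_simp
    rw [e, ← mul_sub]
    refine mul_le_mul_of_nonneg_left ?_ hBtc.le
    have p1 : 0 ≤ Real.exp (-(km * xp)) / km := by positivity
    have p2 : Real.exp (-(kp * xm)) / kp ≤ 0 :=
      div_nonpos_of_nonneg_of_nonpos (Real.exp_pos _).le hkp.le
    linarith
  have g1 : t * ((∫ y, a y) - (∫ y in Ioi xm, a y)) ≤ c2 * L := by
    calc _ ≤ t * (c2 * Real.exp (km * xm)) := by gcongr
      _ = c2 * L := by rw [xm1]; field_simp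
  have g2 : t * (∫ y in Ioi xp, a y) ≤ c2 * L := by
    calc _ ≤ t * (c2 * Real.exp (kp * xp)) := by gcongr
      _ = c2 * L := by rw [xp1]; field_simp
  have g3 : Real.exp (-(4 * c2 * L) - E) * Real.exp (t * ∫ y, a y) ≤ 4 * ‖fL Q t‖ := by
    refine le_trans ?_ key
    rw [← Real.exp_add]
    refine Real.exp_le_exp.2 ?_
    linarith
  linarith

lemma mono_fL {a : ℝ → ℝ} {Q : ℝ → ℂ} (H : Hyp a Q) (hA : 0 < ∫ y, a y) {δ : ℝ} (hδ : 0 < δ)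
    (hlow : ∀ᶠ t : ℝ in atTop, δ * Real.exp (t * ∫ y, a y) ≤ ‖fL Q t‖) :
    ∃ z₀ : ℝ, 0 < z₀ ∧ StrictMonoOn (fun t : ℝ => ‖fL Q t‖ ^ 2) (Ici z₀) := by
  set A := ∫ y, a y with hAdef
  obtain ⟨T, hT⟩ := eventually_atTop.1 hlow
  set z₀ := max (max T 1) (1 / (A * δ)) with hz₀
  have hz1 : 1 ≤ z₀ := (le_max_right _ _).trans (le_max_left _ _)
  refine ⟨z₀, by linarith, ?_⟩
  set h : ℂ → ℂ := fun z => fL Q z * Complex.exp (-(A * z)) with hh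
  have hhd : Differentiable ℂ h := (fL_diff H).mul (by fun_prop)
  have hen : ∀ z : ℂ, ‖Complex.exp (-(A * z))‖ = Real.exp (-(z.re * A)) := by
    intro z
    rw [Complex.norm_exp]
    simp [mul_comm]
  have hle : ∀ z : ℂ, 0 ≤ z.re → ‖h z‖ ≤ 1 := by
    intro z hz
    simp only [hh, norm_mul, hen]
    rw [Real.exp_neg, ← div_eq_mul_inv, div_le_one (Real.exp_pos _)]
    exact fL_le H z hz
  have hder : ∀ t : ℝ, 0 < t → ‖deriv h t‖ ≤ 1 / t := by
    intro t ht
    refine Complex.norm_deriv_le_of_forall_mem_sphere_norm_le ht hhd.diffContOnCl fun z hz => ?_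
    refine hle z ?_
    have h1 : ‖z - t‖ = t := by simpa [dist_eq_norm] using hz
    have h2 := Complex.abs_re_le_norm (z - t)
    rw [h1] at h2
    have := (abs_le.1 h2).1
    simp at this
    exact this
  have hnorm : ∀ t : ℝ, ‖h t‖ = ‖fL Q t‖ * Real.exp (-(t * A)) := by
    intro t
    simp only [hh, norm_mul, hen, Complex.ofReal_re]
  have hlow2 : ∀ t : ℝ, T ≤ t → δ ≤ ‖h t‖ := by
    intro t ht
    rw [hnorm, Real.exp_neg, ← div_eq_mul_inv, le_div_iff₀ (Real.exp_pos _)]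
    exact hT t ht
  have e : (fun t : ℝ => ‖fL Q t‖ ^ 2) = fun t : ℝ => ‖h t‖ ^ 2 * Real.exp (2 * A * t) := by
    funext t
    rw [hnorm, mul_pow, ← Real.exp_nat_mul, mul_assoc, ← Real.exp_add]
    have : ((2 : ℕ) : ℝ) * -(t * A) + 2 * A * t = 0 := by push_cast; ring
    rw [this]
    simp
  rw [e]
  have hd : ∀ t : ℝ, HasDerivAt (fun t : ℝ => ‖h t‖ ^ 2 * Real.exp (2 * A * t))
      ((2 * inner ℝ (h t) (deriv h t)) * Real.exp (2 * A * t) +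
        ‖h t‖ ^ 2 * (Real.exp (2 * A * t) * (2 * A * 1))) t := fun t =>
    (((hhd t).hasDerivAt.comp_ofReal).norm_sq).mul (((hasDerivAt_id t).const_mul (2 * A)).exp)
  refine strictMonoOn_of_deriv_pos (convex_Ici _)
    (fun t _ => (hd t).continuousAt.continuousWithinAt) fun t ht => ?_
  rw [interior_Ici] at ht
  have ht' : z₀ < t := ht
  have ht0 : 0 < t := by linarith
  rw [(hd t).deriv]
  have l1 := hlow2 t (((le_max_left _ _).trans (le_max_left _ _)).trans ht'.le)
  have l2 := hder t ht0
  have l3 : 1 / t < A * δ := by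
    have : 1 / (A * δ) < t := (le_max_right _ _).trans_lt ht'
    rw [div_lt_iff₀ (by positivity)] at this
    rw [div_lt_iff₀ ht0]
    linarith
  have l4 : -(‖h t‖ * ‖deriv h t‖) ≤ inner ℝ (h t) (deriv h t) :=
    (abs_le.1 (abs_real_inner_le_norm _ _)).1
  have l5 : 0 < ‖h t‖ := by linarith
  have l6 : ‖deriv h t‖ < A * ‖h t‖ := by
    have := mul_le_mul_of_nonneg_left l1 hA.le
    linarith
  have l7 : 0 < inner ℝ (h t) (deriv h t) + A * ‖h t‖ ^ 2 := by
    nlinarith [mul_lt_mul_of_pos_left l6 l5]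
  nlinarith [mul_pos l7 (Real.exp_pos (2 * A * t))]

end Helper

section Alg

noncomputable def Qf (q : ℝ → ℂ) (lam : ℝ) : ℝ → ℂ :=
  fun x => Complex.exp (-(2 * Complex.I * (lam : ℂ) * (x : ℂ))) * q x

lemma cjQf (q : ℝ → ℂ) (lam x : ℝ) :
    cj (Qf q lam) x = Complex.exp (2 * Complex.I * (lam : ℂ) * (x : ℂ)) * (starRingEnd ℂ) (q x) := by
  simp only [cj, Qf, map_mul, ← Complex.exp_conj, map_neg, Complex.conj_I, Complex.conj_ofReal, map_ofNat]
  congr 2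
  ring

lemma exp_sub_split (lam t y : ℝ) :
    Complex.exp (2 * Complex.I * (lam : ℂ) * ((t : ℂ) - (y : ℂ))) =
      Complex.exp (2 * Complex.I * (lam : ℂ) * (t : ℂ)) *
        Complex.exp (-(2 * Complex.I * (lam : ℂ) * (y : ℂ))) := by
  rw [← Complex.exp_add]; congr 1; ring

lemma mL1_eq (q : ℝ → ℂ) (lam : ℝ) (n : ℕ) :
    ∀ x, mL1 q lam n x = It (2 * n) (Qf q lam) (cj (Qf q lam)) x := by
  induction n with
  | zero => intro x; simp [mL1, It]
  | succ n ih =>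
    intro x
    show _ = ∫ y in Ioi x, Qf q lam y * ∫ t in Ioi y, cj (Qf q lam) t *
      It (2 * n) (Qf q lam) (cj (Qf q lam)) t
    simp only [mL1]
    congr 1; funext y
    rw [← integral_const_mul]
    congr 1; funext t
    rw [ih, cjQf, exp_sub_split, Qf]
    ring

lemma mL3_eq (q : ℝ → ℂ) (lam : ℝ) (n : ℕ) :
    ∀ x, mL3 q lam n x = Complex.exp (-(2 * Complex.I * (lam : ℂ) * (x : ℂ))) *
      (Complex.I * It (2 * n + 1) (cj (Qf q lam)) (Qf q lam) x) := by
  induction n with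
  | zero =>
    intro x
    show _ = _ * (_ * ∫ y in Ioi x, cj (Qf q lam) y * 1)
    simp only [mL3]
    rw [mul_left_comm (Complex.exp _), ← integral_const_mul (Complex.exp _)]
    congr 2; funext y
    rw [cjQf, exp_sub_split]; ring
  | succ n ih =>
    intro x
    show _ = _ * (_ * ∫ y in Ioi x, cj (Qf q lam) y * ∫ t in Ioi y, Qf q lam t *
      It (2 * n + 1) (cj (Qf q lam)) (Qf q lam) t)
    simp only [mL3]
    rw [← mul_assoc, ← integral_const_mul]
    congr 1; funext y
    rw [← mul_assoc, ← integral_const_mul]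
    congr 1; funext t
    rw [ih, cjQf, exp_sub_split, Qf]
    ring

lemma aL1_eq (q : ℝ → ℂ) (lam : ℝ) (z : ℂ) : aL1 q lam z = fL (Qf q lam) z := by
  have h : ∀ x, q x * ML3 q lam x z = Complex.I * (Qf q lam x * be (Qf q lam) z x) := by
    intro x
    simp only [ML3, be, Par, mL3_eq]
    rw [← tsum_mul_left, ← mul_assoc, ← tsum_mul_left]
    congr 1; funext n
    simp only [Qf]; ring
  simp only [aL1, fL, h]
  rw [integral_const_mul]
  linear_combination (-z * ∫ x, Qf q lam x * be (Qf q lam) z x) * Complex.I_mul_I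

lemma aL3_eq (q : ℝ → ℂ) (lam : ℝ) (z : ℂ) : aL3 q lam z = Complex.I * gL (Qf q lam) z := by
  have h : ∀ x, ML1 q lam x z = al (Qf q lam) z x := by
    intro x
    simp only [ML1, al, Par, mL1_eq]
  simp only [aL3, gL, h, ← cjQf]
  ring

lemma exp_conj_pos (lam u : ℝ) :
    (starRingEnd ℂ) (Complex.exp (2 * Complex.I * (lam : ℂ) * (u : ℂ))) =
    Complex.exp (-(2 * Complex.I * (lam : ℂ) * (u : ℂ))) := by
  rw [← Complex.exp_conj]
  simp only [map_mul, Complex.conj_I, Complex.conj_ofReal, map_ofNat]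
  congr 1
  ring

lemma mL4_eq (q : ℝ → ℂ) (lam : ℝ) (n : ℕ) :
    ∀ x, mL4 q lam n x = (starRingEnd ℂ) (mL1 q lam n x) := by
  induction n with
  | zero => intro x; simp [mL1, mL4]
  | succ n ih =>
    intro x
    simp only [mL1, mL4]
    rw [← integral_conj]
    congr 1; funext y
    rw [← integral_conj]
    congr 1; funext t
    have := exp_conj_pos lam (t - y)
    push_cast at this
    simp only [map_mul (starRingEnd ℂ) (_ * _), map_mul (starRingEnd ℂ) (Complex.exp _), this, ih, Complex.conj_conj]

lemma mL2_eq (q : ℝ → ℂ) (lam : ℝ) (n : ℕ) :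
    ∀ x, mL2 q lam n x = (starRingEnd ℂ) (mL3 q lam n x) := by
  induction n with
  | zero =>
    intro x
    simp only [mL3, mL2]
    rw [map_mul, ← integral_conj, Complex.conj_I]
    congr 2; funext y
    have := exp_conj_pos lam (y - x)
    push_cast at this
    simp only [map_mul (starRingEnd ℂ) (Complex.exp _), this, Complex.conj_conj]
  | succ n ih =>
    intro x
    simp only [mL3, mL2]
    rw [← integral_conj]
    congr 1; funext y
    rw [← integral_conj]
    congr 1; funext t
    have := exp_conj_pos lam (y - x)
    push_cast at this
    simp only [map_mul (starRingEnd ℂ) (_ * _), map_mul (starRingEnd ℂ) (Complex.exp _), this, ih, Complex.conj_conj]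

lemma aL4_eq (q : ℝ → ℂ) (lam : ℝ) (z : ℝ) : aL4 q lam z = (starRingEnd ℂ) (aL1 q lam z) := by
  simp only [aL4, aL1, ML2, ML3, mL2_eq]
  rw [map_sub, map_one, map_mul, ← integral_conj, map_mul, Complex.conj_I, Complex.conj_ofReal]
  have : ∀ x, (starRingEnd ℂ) (q x * ∑' n, mL3 q lam n x * (z:ℂ) ^ (2 * n + 1)) =
      (starRingEnd ℂ) (q x) * ∑' n, (starRingEnd ℂ) (mL3 q lam n x) * (z:ℂ) ^ (2 * n + 1) := by
    intro x
    rw [map_mul, Complex.conj_tsum]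
    simp only [map_mul, map_pow, Complex.conj_ofReal]
  simp only [this]
  ring

lemma aL2_eq (q : ℝ → ℂ) (lam : ℝ) (z : ℝ) : aL2 q lam z = (starRingEnd ℂ) (aL3 q lam z) := by
  simp only [aL2, aL3, ML4, ML1, mL4_eq]
  rw [map_mul, ← integral_conj, map_mul, Complex.conj_I, Complex.conj_ofReal]
  congr 2; funext x
  rw [map_mul, map_mul, Complex.conj_tsum, exp_conj_pos, Complex.conj_conj]
  simp only [map_mul, map_pow, Complex.conj_ofReal]

end Alg

section Ana

lemma exp_km_bot {k : ℝ} (hk : 0 < k) : Tendsto (fun x => Real.exp (k * x)) atBot (nhds 0) :=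
  Real.tendsto_exp_atBot.comp (tendsto_id.const_mul_atBot hk)

lemma exp_kp_top {k : ℝ} (hk : k < 0) : Tendsto (fun x => Real.exp (k * x)) atTop (nhds 0) :=
  Real.tendsto_exp_atBot.comp (tendsto_id.const_mul_atTop_of_neg hk)

lemma Cfun_deriv {c : ℝ → ℝ} {Om k : ℝ} (hk : 0 < k) (hc : Continuous c)
    (hc_m : Asymptotics.IsBigO atBot (fun x => c x - Om) (fun x => Real.exp (2 * k * x)))
    (K x : ℝ) : HasDerivAt (Cfun c Om K) (c x) x := by
  have hg : Continuous (fun s => c s - Om) := by fun_prop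
  have hint : ∀ x, IntegrableOn (fun s => c s - Om) (Iic x) := by
    intro x
    refine LocallyIntegrableOn.integrableOn_of_isBigO_atBot
      (hg.locallyIntegrable.locallyIntegrableOn _) hc_m ?_
    exact ⟨Iic 0, Iic_mem_atBot 0, integrableOn_exp_mul_Iic (by positivity) 0⟩
  have h : (Cfun c Om K) = fun x => (∫ s in Iic (0:ℝ), (c s - Om)) + (∫ s in (0:ℝ)..x, (c s - Om)) + Om * x + K := by
    funext x
    rw [← intervalIntegral.integral_Iic_sub_Iic (hint 0) (hint x)]
    simp only [Cfun]; ring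
  rw [h]
  have h1 := intervalIntegral.integral_hasDerivAt_right (hg.intervalIntegrable 0 x)
    (hg.stronglyMeasurableAtFilter _ _) hg.continuousAt
  have h2 := (((h1.const_add (∫ s in Iic (0:ℝ), (c s - Om))).add ((hasDerivAt_id x).const_mul Om)).add_const K)
  exact h2.congr_deriv (by ring)

/-- Eventual lower bounds at both ends and continuity with positivity give a global one. -/
lemma glob_lower {f : ℝ → ℝ} (hf : Continuous f) (hpos : ∀ x, 0 < f x) {e : ℝ} (he : 0 < e)
    (h1 : ∀ᶠ x in atBot, e ≤ f x) (h2 : ∀ᶠ x in atTop, e ≤ f x) : ∃ c1 > 0, ∀ x, c1 ≤ f x := by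
  obtain ⟨u, hu⟩ := eventually_atBot.1 h1
  obtain ⟨v, hv⟩ := eventually_atTop.1 h2
  obtain ⟨m, hm, hmin⟩ := (isCompact_Icc (a := min u v) (b := max u v)).exists_isMinOn
    ⟨min u v, by simp⟩ hf.continuousOn
  refine ⟨min e (f m), lt_min he (hpos m), fun x => ?_⟩
  by_cases hx : x ≤ u
  · exact (min_le_left _ _).trans (hu x hx)
  by_cases hx' : v ≤ x
  · exact (min_le_left _ _).trans (hv x hx')
  push Not at hx hx'
  exact (min_le_right _ _).trans (hmin ⟨(min_le_left _ _).trans hx.le, hx'.le.trans (le_max_right _ _)⟩)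

lemma bdd_of_ends {c : ℝ → ℝ} (hc : Continuous c) {l1 l2 : ℝ} (h1 : Tendsto c atBot (nhds l1))
    (h2 : Tendsto c atTop (nhds l2)) (lam : ℝ) : ∃ B > 0, ∀ x, |c x - lam| ≤ B := by
  have g1 : Tendsto (fun x => |c x - lam|) atBot (nhds |l1 - lam|) := (h1.sub_const lam).abs
  have g2 : Tendsto (fun x => |c x - lam|) atTop (nhds |l2 - lam|) := (h2.sub_const lam).abs
  obtain ⟨u, hu⟩ := eventually_atBot.1 (g1.eventually (gt_mem_nhds (lt_add_one _)))
  obtain ⟨v, hv⟩ := eventually_atTop.1 (g2.eventually (gt_mem_nhds (lt_add_one _)))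
  obtain ⟨m, hm, hmax⟩ := (isCompact_Icc (a := min u v) (b := max u v)).exists_isMaxOn
    ⟨min u v, by simp⟩ (f := fun x => |c x - lam|) (by fun_prop)
  refine ⟨|l1 - lam| + 1 + (|l2 - lam| + 1) + |c m - lam|, by positivity, fun x => ?_⟩
  have p1 := abs_nonneg (l1 - lam)
  have p2 := abs_nonneg (l2 - lam)
  have p3 := abs_nonneg (c m - lam)
  by_cases hx : x ≤ u
  · have := hu x hx; linarith
  by_cases hx' : v ≤ x
  · have := hv x hx'; linarith
  push Not at hx hx'
  have : |c x - lam| ≤ |c m - lam| :=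
    hmax ⟨(min_le_left _ _).trans hx.le, hx'.le.trans (le_max_right _ _)⟩
  linarith

lemma tends_of_bigO {l : Filter ℝ} {c e : ℝ → ℝ} {Om : ℝ}
    (h : Asymptotics.IsBigO l (fun x => c x - Om) e) (he : Tendsto e l (nhds 0)) :
    Tendsto c l (nhds Om) := by
  have := (h.trans_tendsto he).add_const Om
  simpa using this

lemma ratio_tends {l : Filter ℝ} {a : ℝ → ℝ} {k am : ℝ}
    (h : Asymptotics.IsBigO l (fun x => a x - am * Real.exp (k * x)) (fun x => Real.exp (3 * k * x)))
    (he : Tendsto (fun x => Real.exp (2 * k * x)) l (nhds 0)) :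
    Tendsto (fun x => a x * Real.exp (-(k * x))) l (nhds am) := by
  refine tends_of_bigO (e := fun x => Real.exp (2 * k * x)) ?_ he
  have := h.mul (Asymptotics.isBigO_refl (fun x => Real.exp (-(k * x))) l)
  refine (this.congr (fun x => ?_) (fun x => ?_))
  · rw [sub_mul, mul_assoc, ← Real.exp_add]; simp
  · rw [← Real.exp_add]; congr 1; ring

lemma tail_bot {a : ℝ → ℝ} (ha : Integrable a) {k M : ℝ} (hk : 0 < k)
    (h : ∀ᶠ x in atBot, a x * Real.exp (-(k * x)) ≤ M) :
    ∀ᶠ x in atBot, (∫ y, a y) - (∫ y in Ioi x, a y) ≤ M / k * Real.exp (k * x) := by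
  obtain ⟨u, hu⟩ := eventually_atBot.1 h
  filter_upwards [eventually_le_atBot u] with x hx
  rw [← intervalIntegral.integral_Iic_add_Ioi (b := x) ha.integrableOn ha.integrableOn, add_sub_cancel_right]
  have : ∫ y in Iic x, a y ≤ ∫ y in Iic x, M * Real.exp (k * y) := by
    refine setIntegral_mono_on ha.integrableOn ((integrableOn_exp_mul_Iic hk x).const_mul M) measurableSet_Iic ?_
    intro y hy
    have := mul_le_mul_of_nonneg_right (hu y (le_trans hy hx)) (Real.exp_pos (k * y)).le
    rwa [mul_assoc, ← Real.exp_add, neg_add_cancel, Real.exp_zero, mul_one] at this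
  rw [integral_const_mul, integral_exp_mul_Iic hk] at this
  refine this.trans (le_of_eq (by ring))

lemma tail_top {a : ℝ → ℝ} (ha : Integrable a) {k M : ℝ} (hk : k < 0)
    (h : ∀ᶠ x in atTop, a x * Real.exp (-(k * x)) ≤ M) :
    ∀ᶠ x in atTop, (∫ y in Ioi x, a y) ≤ M / (-k) * Real.exp (k * x) := by
  obtain ⟨u, hu⟩ := eventually_atTop.1 h
  filter_upwards [eventually_ge_atTop u] with x hx
  have : ∫ y in Ioi x, a y ≤ ∫ y in Ioi x, M * Real.exp (k * y) := by
    refine setIntegral_mono_on ha.integrableOn ((integrableOn_exp_mul_Ioi hk x).const_mul M) measurableSet_Ioi ?_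
    intro y hy
    have := mul_le_mul_of_nonneg_right (hu y (hx.trans (le_of_lt hy))) (Real.exp_pos (k * y)).le
    rwa [mul_assoc, ← Real.exp_add, neg_add_cancel, Real.exp_zero, mul_one] at this
  rw [integral_const_mul, integral_exp_mul_Ioi hk] at this
  refine this.trans (le_of_eq (by rw [div_neg]; ring))

end Ana

theorem stmt15
    (kappam kappap aminus aplus : ℝ)
    (hkm : 0 < kappam) (hkp : kappap < 0) (ham : 0 < aminus) (hap : 0 < aplus)
    (a : ℝ → ℝ) (ha_pos : ∀ x, 0 < a x) (ha_C1 : ContDiff ℝ 1 a)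
    (ha_m : Asymptotics.IsBigO atBot
      (fun x => a x - aminus * Real.exp (kappam * x)) (fun x => Real.exp (3 * kappam * x)))
    (ha'_m : Asymptotics.IsBigO atBot
      (fun x => deriv a x - aminus * kappam * Real.exp (kappam * x))
      (fun x => Real.exp (3 * kappam * x)))
    (ha_p : Asymptotics.IsBigO atTop
      (fun x => a x - aplus * Real.exp (kappap * x)) (fun x => Real.exp (3 * kappap * x)))
    (ha'_p : Asymptotics.IsBigO atTop
      (fun x => deriv a x - aplus * kappap * Real.exp (kappap * x))
      (fun x => Real.exp (3 * kappap * x)))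
    (ha_int : Integrable a)
    (c : ℝ → ℝ) (hc_C1 : ContDiff ℝ 1 c) (Omegam Omegap : ℝ)
    (hc_m : Asymptotics.IsBigO atBot (fun x => c x - Omegam) (fun x => Real.exp (2 * kappam * x)))
    (hc'_m : Asymptotics.IsBigO atBot (fun x => deriv c x) (fun x => Real.exp (2 * kappam * x)))
    (hc_p : Asymptotics.IsBigO atTop (fun x => c x - Omegap) (fun x => Real.exp (2 * kappap * x)))
    (hc'_p : Asymptotics.IsBigO atTop (fun x => deriv c x) (fun x => Real.exp (2 * kappap * x)))
    (lam K : ℝ) :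
    ∃ z₀ : ℝ, 0 < z₀ ∧
      StrictMonoOn (fun z : ℝ => ‖aL1 (qfun a c Omegam K) lam (z : ℂ)‖) (Ici z₀) ∧
      StrictMonoOn (fun z : ℝ => ‖aL2 (qfun a c Omegam K) lam (z : ℂ)‖) (Ici z₀) ∧
      StrictMonoOn (fun z : ℝ => ‖aL3 (qfun a c Omegam K) lam (z : ℂ)‖) (Ici z₀) ∧
      StrictMonoOn (fun z : ℝ => ‖aL4 (qfun a c Omegam K) lam (z : ℂ)‖) (Ici z₀) := by
  have hac : Continuous a := ha_C1.continuous
  have hcc : Continuous c := hc_C1.continuous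
  set Φ : ℝ → ℝ := fun x => Cfun c Omegam K x - lam * x with hΦdef
  have hΦ : ∀ x, HasDerivAt Φ (c x - lam) x := fun x =>
    ((Cfun_deriv hkm hcc hc_m K x).sub ((hasDerivAt_id x).const_mul lam)).congr_deriv (by ring)
  set Q := Qf (qfun a c Omegam K) lam with hQdef
  have hQ : ∀ x, Q x = (a x : ℂ) * Complex.exp (2 * Complex.I * (Φ x : ℂ)) := by
    intro x
    simp only [hQdef, Qf, qfun, hΦdef]
    rw [mul_left_comm, ← Complex.exp_add]
    congr 2
    push_cast
    ring
  have hΦc : Continuous Φ := continuous_iff_continuousAt.2 fun x => (hΦ x).continuousAt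
  have H : Hyp a Q := by
    refine ⟨hac, fun x => (ha_pos x).le, ha_int, ?_, fun x => ?_⟩
    · rw [funext hQ]
      fun_prop
    · rw [hQ, norm_mul, Complex.norm_exp]
      simp [abs_of_pos (ha_pos x)]
  have e2m : Tendsto (fun x => Real.exp (2 * kappam * x)) atBot (nhds 0) := exp_km_bot (by positivity)
  have e2p : Tendsto (fun x => Real.exp (2 * kappap * x)) atTop (nhds 0) := exp_kp_top (by linarith)
  obtain ⟨B, hB0, hB⟩ := bdd_of_ends hcc (tends_of_bigO hc_m e2m) (tends_of_bigO hc_p e2p) lam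
  have rm := ratio_tends ha_m e2m
  have rp := ratio_tends ha_p e2p
  obtain ⟨c1, hc1, hlow⟩ := glob_lower
    (f := fun x => a x * (Real.exp (-(kappam * x)) + Real.exp (-(kappap * x)))) (by fun_prop)
    (fun x => mul_pos (ha_pos x) (by positivity)) (e := min (aminus / 2) (aplus / 2))
    (lt_min (by positivity) (by positivity))
    (by
      filter_upwards [rm.eventually (lt_mem_nhds (half_lt_self ham))] with x hx
      refine (min_le_left _ _).trans (hx.le.trans ?_)
      rw [mul_add]
      exact le_add_of_nonneg_right (mul_nonneg (ha_pos x).le (Real.exp_pos _).le))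
    (by
      filter_upwards [rp.eventually (lt_mem_nhds (half_lt_self hap))] with x hx
      refine (min_le_right _ _).trans (hx.le.trans ?_)
      rw [mul_add]
      exact le_add_of_nonneg_left (mul_nonneg (ha_pos x).le (Real.exp_pos _).le))
  have tm := tail_bot ha_int hkm ((rm.eventually (gt_mem_nhds (lt_add_one aminus))).mono fun x hx => hx.le)
  have tp := tail_top ha_int hkp ((rp.eventually (gt_mem_nhds (lt_add_one aplus))).mono fun x hx => hx.le)
  obtain ⟨δ, hδ, hfl⟩ := lower_exp H hQ hΦ hB0 hB hkm hkp hc1 hlow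
    (c2 := max ((aminus + 1) / kappam) ((aplus + 1) / (-kappap)))
    (tm.mono fun x hx => hx.trans (mul_le_mul_of_nonneg_right (le_max_left _ _) (Real.exp_pos _).le))
    (tp.mono fun x hx => hx.trans (mul_le_mul_of_nonneg_right (le_max_right _ _) (Real.exp_pos _).le))
  have hA : 0 < ∫ y, a y := by
    rw [integral_pos_iff_support_of_nonneg (fun x => (ha_pos x).le) ha_int]
    have : Function.support a = univ := by
      ext x; simp [(ha_pos x).ne']
    rw [this]; simp
  obtain ⟨z₀, hz₀, hmono⟩ := mono_fL H hA hδ hfl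
  have m1 : StrictMonoOn (fun z : ℝ => ‖fL Q (z : ℂ)‖) (Ici z₀) := by
    intro s hs t ht hst
    exact lt_of_pow_lt_pow_left₀ 2 (norm_nonneg _) (hmono hs ht hst)
  have m3 : StrictMonoOn (fun z : ℝ => ‖gL Q (z : ℂ)‖) (Ici z₀) := by
    intro s hs t ht hst
    have h1 := hmono hs ht hst
    have h2 := conservL H s
    have h3 := conservL H t
    simp only at h1
    exact lt_of_pow_lt_pow_left₀ 2 (norm_nonneg _) (by linarith)
  refine ⟨z₀, hz₀, ?_, ?_, ?_, ?_⟩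
  · simpa only [aL1_eq] using m1
  · simpa only [aL2_eq, aL3_eq, RCLike.norm_conj, norm_mul, Complex.norm_I, one_mul] using m3
  · simpa only [aL3_eq, norm_mul, Complex.norm_I, one_mul] using m3
  · simpa only [aL4_eq, aL1_eq, RCLike.norm_conj] using m1
end

section
/- If u : ℝ → ℂ is twice differentiable and satisfies, for all x ∈ ℝ, −u''(x) + (a'(x)/a(x)) u'(x) + z² a(x)² u(x) − iλ (a'(x)/a(x)) u(x) + s(x) u(x) = λ² u(x), where s(x) = −i c'(x) − c(x)² + i (a'(x)/a(x)) c(x) + 2λ c(x), then the function y : (0,A) → ℂ defined by y(X) = u(φ(X)) is twice differentiable and satisfies, for all X ∈ (0,A), y''(X) + Q(X) y(X) = z² y(X). -/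
open MeasureTheory Set

theorem stmt16
    (a : ℝ → ℝ) (ha_pos : ∀ x, 0 < a x) (ha_C1 : ContDiff ℝ 1 a) (ha_int : Integrable a)
    (A : ℝ) (hA : A = ∫ x : ℝ, a x)
    (g : ℝ → ℝ) (hg : ∀ x, g x = ∫ t in Iic x, a t)
    (φ : ℝ → ℝ) (hφg : ∀ x, φ (g x) = x) (hgφ : ∀ X ∈ Ioo 0 A, g (φ X) = X)
    (c : ℝ → ℝ) (hc_C1 : ContDiff ℝ 1 c)
    (lam : ℝ) (z : ℂ)
    (Q : ℝ → ℂ)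
    (hQ : ∀ X : ℝ, Q X =
      (((lam - c (φ X)) ^ 2 / a (φ X) ^ 2 : ℝ) : ℂ) +
        Complex.I *
          (((a (φ X) * deriv c (φ X) + deriv a (φ X) * (lam - c (φ X))) / a (φ X) ^ 3 : ℝ) : ℂ))
    (u : ℝ → ℂ) (hu1 : Differentiable ℝ u) (hu2 : Differentiable ℝ (deriv u))
    (hode : ∀ x : ℝ,
      -deriv (deriv u) x + ((deriv a x / a x : ℝ) : ℂ) * deriv u x +
          z ^ 2 * ((a x : ℝ) : ℂ) ^ 2 * u x -
          Complex.I * (lam : ℂ) * ((deriv a x / a x : ℝ) : ℂ) * u x +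
          (-Complex.I * ((deriv c x : ℝ) : ℂ) - ((c x : ℝ) : ℂ) ^ 2 +
              Complex.I * ((deriv a x / a x : ℝ) : ℂ) * ((c x : ℝ) : ℂ) +
              2 * (lam : ℂ) * ((c x : ℝ) : ℂ)) * u x =
        (lam : ℂ) ^ 2 * u x) :
    (∀ X ∈ Ioo 0 A, DifferentiableAt ℝ (fun Y => u (φ Y)) X) ∧
    (∀ X ∈ Ioo 0 A, DifferentiableAt ℝ (deriv fun Y => u (φ Y)) X) ∧
    ∀ X ∈ Ioo 0 A,
      deriv (deriv fun Y => u (φ Y)) X + Q X * u (φ X) = z ^ 2 * u (φ X) := by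
  have ha_cont : Continuous a := ha_C1.continuous
  have ha_diff : Differentiable ℝ a := ha_C1.differentiable (by norm_num)
  have hgs : ∀ x, HasStrictDerivAt g (a x) x := by
    intro x
    have h1 : g = fun x => (∫ t in Iic (0:ℝ), a t) + ∫ t in (0:ℝ)..x, a t := by
      funext y
      rw [hg y, ← intervalIntegral.integral_Iic_sub_Iic ha_int.integrableOn ha_int.integrableOn]
      ring
    rw [h1]
    exact (intervalIntegral.integral_hasStrictDerivAt_right
      (ha_cont.intervalIntegrable _ _) (ha_cont.stronglyMeasurableAtFilter _ _)
      ha_cont.continuousAt).const_add _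
  have hφ : ∀ X ∈ Ioo 0 A, HasDerivAt φ (a (φ X))⁻¹ X := by
    intro X hX
    have h := (hgs (φ X)).to_local_left_inverse (ha_pos _).ne'
      (g := φ) (Filter.Eventually.of_forall hφg)
    rw [hgφ X hX] at h
    exact h.hasDerivAt
  have hy : ∀ X ∈ Ioo 0 A,
      HasDerivAt (fun Y => u (φ Y)) ((a (φ X))⁻¹ • deriv u (φ X)) X := by
    intro X hX
    exact (hu1 (φ X)).hasDerivAt.scomp X (hφ X hX)
  have hy2 : ∀ X ∈ Ioo 0 A, HasDerivAt (deriv fun Y => u (φ Y))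
      ((a (φ X))⁻¹ • ((a (φ X))⁻¹ • deriv (deriv u) (φ X)) +
        (-(deriv a (φ X) * (a (φ X))⁻¹) / (a (φ X)) ^ 2) • deriv u (φ X)) X := by
    intro X hX
    have h1 := (hu2 (φ X)).hasDerivAt.scomp X (hφ X hX)
    have h2 := ((ha_diff (φ X)).hasDerivAt.comp X (hφ X hX)).inv (ha_pos _).ne'
    refine (h2.smul h1).congr_of_eventuallyEq ?_
    filter_upwards [isOpen_Ioo.mem_nhds hX] with Y hY
    exact (hy Y hY).deriv
  refine ⟨fun X hX => (hy X hX).differentiableAt, fun X hX => (hy2 X hX).differentiableAt, ?_⟩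
  intro X hX
  rw [(hy2 X hX).deriv, hQ X]
  have hne : ((a (φ X) : ℝ) : ℂ) ≠ 0 := by exact_mod_cast (ha_pos (φ X)).ne'
  have ho := hode (φ X)
  generalize φ X = x at *
  have ho2 : deriv (deriv u) x = ((deriv a x / a x : ℝ) : ℂ) * deriv u x +
          z ^ 2 * ((a x : ℝ) : ℂ) ^ 2 * u x -
          Complex.I * (lam : ℂ) * ((deriv a x / a x : ℝ) : ℂ) * u x +
          (-Complex.I * ((deriv c x : ℝ) : ℂ) - ((c x : ℝ) : ℂ) ^ 2 +
              Complex.I * ((deriv a x / a x : ℝ) : ℂ) * ((c x : ℝ) : ℂ) +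
              2 * (lam : ℂ) * ((c x : ℝ) : ℂ)) * u x - (lam : ℂ) ^ 2 * u x := by
    linear_combination -ho
  rw [ho2]
  simp only [Complex.real_smul]
  push_cast
  field_simp
  ring
end

section
/- Set λ⁺ = λ − Ω₊ and ω₊ = (λ⁺/κ₊)² + i λ⁺/κ₊. Then for every X₀ ∈ (0,A) there exists M > 0 such that |Q(X) − ω₊/(A−X)²| ≤ M for all X ∈ (X₀, A); that is, Q(X) = ω₊/(A−X)² + q₊(X) with q₊ bounded on (X₀,A). -/
open MeasureTheory Set Filter

theorem aux_tail (k ap : ℝ) (hk : k < 0) (a : ℝ → ℝ) (ha_int : Integrable a)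
    (ha_p : Asymptotics.IsBigO atTop
      (fun x => a x - ap * Real.exp (k * x)) (fun x => Real.exp (3 * k * x))) :
    Asymptotics.IsBigO atTop
      (fun x => (-k * ∫ t in Ioi x, a t) - ap * Real.exp (k * x))
      (fun x => Real.exp (3 * k * x)) := by
  obtain ⟨C, hC⟩ := ha_p.bound
  obtain ⟨N, hN⟩ := eventually_atTop.1 hC
  refine Asymptotics.IsBigO.of_bound (C / 3) ?_
  filter_upwards [eventually_ge_atTop N] with x hx
  have hk0 : k ≠ 0 := hk.ne
  have h3 : 3 * k < 0 := by linarith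
  have i1 := integral_exp_mul_Ioi hk x
  have i3 := integral_exp_mul_Ioi h3 x
  have j1 := integrableOn_exp_mul_Ioi hk x
  have j3 := integrableOn_exp_mul_Ioi h3 x
  have e1 : ∫ t in Ioi x, (a t - ap * Real.exp (k * t)) =
      (∫ t in Ioi x, a t) - ap * (- Real.exp (k * x) / k) := by
    rw [integral_sub ha_int.integrableOn (j1.const_mul ap), integral_const_mul, i1]
  have e2 : ‖∫ t in Ioi x, (a t - ap * Real.exp (k * t))‖ ≤
      ∫ t in Ioi x, C * Real.exp (3 * k * t) := by
    refine norm_integral_le_of_norm_le (j3.const_mul C) ?_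
    refine (ae_restrict_iff' measurableSet_Ioi).2 (Eventually.of_forall fun t ht => ?_)
    have := hN t (hx.trans (le_of_lt ht))
    simpa only [Real.norm_eq_abs, abs_of_pos (Real.exp_pos _)] using this
  rw [integral_const_mul, i3, e1] at e2
  have e3 : (-k * ∫ t in Ioi x, a t) - ap * Real.exp (k * x) =
      -k * ((∫ t in Ioi x, a t) - ap * (- Real.exp (k * x) / k)) := by
    field_simp
    ring
  rw [e3, norm_mul, Real.norm_eq_abs (-k), abs_of_pos (by linarith : 0 < -k),
    Real.norm_eq_abs (Real.exp _), abs_of_pos (Real.exp_pos _)]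
  calc _ ≤ -k * (C * (-Real.exp (3 * k * x) / (3 * k))) :=
        mul_le_mul_of_nonneg_left e2 (by linarith)
    _ = _ := by
      field_simp

theorem aux_bdd (f : ℝ → ℝ) (hf : Continuous f)
    (h : Asymptotics.IsBigO atTop f (fun _ => (1 : ℝ))) (x0 : ℝ) :
    ∃ M : ℝ, 0 < M ∧ ∀ x, x0 ≤ x → |f x| ≤ M := by
  obtain ⟨C, hC⟩ := h.bound
  obtain ⟨N, hN⟩ := eventually_atTop.1 hC
  obtain ⟨B, hB⟩ := (isCompact_Icc (a := x0) (b := N)).exists_bound_of_continuousOn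
    hf.continuousOn
  refine ⟨max 1 (max B C), by positivity, fun x hx => ?_⟩
  rcases le_total x N with h1 | h1
  · exact (hB x ⟨hx, h1⟩).trans ((le_max_left _ _).trans (le_max_right _ _))
  · have := hN x h1
    simp only [norm_one, mul_one] at this
    exact this.trans ((le_max_right _ _).trans (le_max_right _ _))

theorem aux_inv (k ap : ℝ) (hk : k < 0) (hap : 0 < ap) (a : ℝ → ℝ)
    (h : Asymptotics.IsBigO atTop
      (fun x => a x - ap * Real.exp (k * x)) (fun x => Real.exp (k * x) ^ 3)) :
    Asymptotics.IsBigO atTop (fun x => (a x)⁻¹) (fun x => (Real.exp (k * x))⁻¹) ∧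
    Asymptotics.IsBigO atTop a (fun x => Real.exp (k * x)) := by
  have hE : Tendsto (fun x => Real.exp (k * x)) atTop (nhds 0) :=
    Real.tendsto_exp_atBot.comp (tendsto_id.const_mul_atTop_of_neg hk)
  have h0 : Asymptotics.IsLittleO atTop
      (fun x => Real.exp (k * x) ^ 3) (fun x => ap * Real.exp (k * x)) := by
    have h1 : Asymptotics.IsLittleO atTop (fun x => Real.exp (k * x) ^ 2)
      (fun _ => (1 : ℝ)) := by
      rw [Asymptotics.isLittleO_one_iff]
      simpa using hE.pow 2
    have h2 := h1.mul_isBigO (Asymptotics.isBigO_refl (fun x => Real.exp (k * x)) atTop)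
    have h3 := h2.trans_isBigO (Asymptotics.isBigO_self_const_mul hap.ne'
      (fun x => 1 * Real.exp (k * x)) atTop)
    refine h3.congr (fun x => ?_) (fun x => ?_) <;> ring
  have he : Asymptotics.IsEquivalent atTop a (fun x => ap * Real.exp (k * x)) :=
    h.trans_isLittleO h0
  have hc : Asymptotics.IsBigO atTop (fun x => ap * Real.exp (k * x))
      (fun x => Real.exp (k * x)) := Asymptotics.isBigO_const_mul_self _ _ _
  have hc' : Asymptotics.IsBigO atTop (fun x => Real.exp (k * x))
      (fun x => ap * Real.exp (k * x)) := Asymptotics.isBigO_self_const_mul hap.ne' _ _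
  refine ⟨?_, he.isBigO.trans hc⟩
  refine (hc'.trans he.isBigO_symm).inv_rev (Eventually.of_forall fun x hx => ?_)
  exact absurd hx (Real.exp_pos _).ne'

theorem stmt17
    (kappap aplus : ℝ) (hkp : kappap < 0) (hap : 0 < aplus)
    (a : ℝ → ℝ) (ha_pos : ∀ x, 0 < a x) (ha_C1 : ContDiff ℝ 1 a) (ha_int : Integrable a)
    (ha_p : Asymptotics.IsBigO atTop
      (fun x => a x - aplus * Real.exp (kappap * x)) (fun x => Real.exp (3 * kappap * x)))
    (ha'_p : Asymptotics.IsBigO atTop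
      (fun x => deriv a x - aplus * kappap * Real.exp (kappap * x))
      (fun x => Real.exp (3 * kappap * x)))
    (c : ℝ → ℝ) (hc_C1 : ContDiff ℝ 1 c) (Omegap : ℝ)
    (hc_p : Asymptotics.IsBigO atTop (fun x => c x - Omegap) (fun x => Real.exp (2 * kappap * x)))
    (hc'_p : Asymptotics.IsBigO atTop (fun x => deriv c x) (fun x => Real.exp (2 * kappap * x)))
    (A : ℝ) (hA : A = ∫ x : ℝ, a x)
    (g : ℝ → ℝ) (hg : ∀ x, g x = ∫ t in Iic x, a t)
    (φ : ℝ → ℝ) (hφg : ∀ x, φ (g x) = x) (hgφ : ∀ X ∈ Ioo 0 A, g (φ X) = X)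
    (lam : ℝ)
    (Q : ℝ → ℂ)
    (hQ : ∀ X : ℝ, Q X =
      (((lam - c (φ X)) ^ 2 / a (φ X) ^ 2 : ℝ) : ℂ) +
        Complex.I *
          (((a (φ X) * deriv c (φ X) + deriv a (φ X) * (lam - c (φ X))) / a (φ X) ^ 3 : ℝ) : ℂ)) :
    ∀ X₀ ∈ Ioo 0 A, ∃ M : ℝ, 0 < M ∧ ∀ X ∈ Ioo X₀ A,
      ‖Q X -
          ((((lam - Omegap) / kappap : ℝ) : ℂ) ^ 2 +
              Complex.I * (((lam - Omegap) / kappap : ℝ) : ℂ)) /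
            ((A - X : ℝ) : ℂ) ^ 2‖ ≤ M := by
  intro X₀ hX₀
  have hgT : ∀ x, A - g x = ∫ t in Ioi x, a t := by
    intro x
    rw [hA, hg, ← intervalIntegral.integral_Iic_add_Ioi ha_int.integrableOn
      (b := x) ha_int.integrableOn]
    ring
  have hgmono : Monotone g := by
    intro x y hxy
    rw [hg, hg]
    exact setIntegral_mono_set ha_int.integrableOn
      (Eventually.of_forall fun t => (ha_pos t).le)
      (Eventually.of_forall (Iic_subset_Iic.2 hxy))
  have hgstrict : StrictMono g :=
    hgmono.strictMono_of_injective (Function.LeftInverse.injective hφg)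
  have hgA : ∀ x, g x < A := by
    intro x
    refine (hgstrict (lt_add_one x)).trans_le ?_
    have := hgT (x + 1)
    have h2 : 0 ≤ ∫ t in Ioi (x + 1), a t := integral_nonneg fun t => (ha_pos t).le
    linarith
  have hgcont : Continuous g := by
    have h1 : g = fun x => g 0 + ∫ t in (0:ℝ)..x, a t := by
      funext x
      rw [← intervalIntegral.integral_Iic_sub_Iic ha_int.integrableOn ha_int.integrableOn,
        hg, hg]
      ring
    rw [h1]
    exact continuous_const.add
      (intervalIntegral.continuous_primitive (fun _ _ => ha_int.intervalIntegrable) 0)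
  set E : ℝ → ℝ := fun x => Real.exp (kappap * x) with hE
  have hE3 : (fun x => Real.exp (3 * kappap * x)) = fun x => E x ^ 3 := by
    funext x
    rw [hE, ← Real.exp_nat_mul]
    congr 1
    push_cast
    ring
  have hE2 : (fun x => Real.exp (2 * kappap * x)) = fun x => E x ^ 2 := by
    funext x
    rw [hE, ← Real.exp_nat_mul]
    congr 1
    push_cast
    ring
  have hEpos : ∀ x, E x ≠ 0 := fun x => (Real.exp_pos _).ne'
  have hS := aux_tail kappap aplus hkp a ha_int ha_p
  rw [hE3] at ha_p ha'_p hS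
  rw [hE2] at hc_p hc'_p
  set S : ℝ → ℝ := fun x => -kappap * ∫ t in Ioi x, a t with hSdef
  have hSg : ∀ x, S x = -kappap * (A - g x) := fun x => by rw [hgT]
  have hSpos : ∀ x, 0 < S x := fun x => by
    rw [hSg]
    exact mul_pos (by linarith) (by linarith [hgA x])
  have hScont : Continuous S := by
    rw [funext hSg]
    fun_prop
  obtain ⟨haI, haE⟩ := aux_inv kappap aplus hkp hap a ha_p
  obtain ⟨hSI, hSE⟩ := aux_inv kappap aplus hkp hap S hS
  have hSa : Asymptotics.IsBigO atTop (fun x => S x - a x) (fun x => E x ^ 3) :=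
    (hS.sub ha_p).congr_left fun x => by ring
  have ha'a : Asymptotics.IsBigO atTop (fun x => deriv a x - kappap * a x)
      (fun x => E x ^ 3) :=
    (ha'_p.sub (ha_p.const_mul_left kappap)).congr_left fun x => by ring
  have hinv : Asymptotics.IsBigO atTop (fun x => (a x ^ 2)⁻¹ - (S x ^ 2)⁻¹)
      (fun _ => (1 : ℝ)) := by
    refine (((hSa.mul (hSE.add haE)).mul (haI.pow 2)).mul (hSI.pow 2)).congr
      (fun x => ?_) (fun x => ?_)
    · have := (ha_pos x).ne'
      have := (hSpos x).ne'
      field_simp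
      ring
    · have := hEpos x
      simp only [hE] at this ⊢
      field_simp
  have hEO : Asymptotics.IsBigO atTop (fun x => E x ^ 2) (fun _ => (1 : ℝ)) := by
    have hEt : Tendsto E atTop (nhds 0) :=
      Real.tendsto_exp_atBot.comp (tendsto_id.const_mul_atTop_of_neg hkp)
    exact (hEt.pow 2).isBigO_one ℝ
  have hl : Asymptotics.IsBigO atTop (fun x => lam - c x) (fun _ => (1 : ℝ)) :=
    ((Asymptotics.isBigO_const_const (lam - Omegap) (one_ne_zero) atTop).sub
      (hc_p.trans hEO)).congr_left fun x => by ring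
  have hl2 : Asymptotics.IsBigO atTop (fun x => lam - c x + (lam - Omegap))
      (fun _ => (1 : ℝ)) :=
    hl.add (Asymptotics.isBigO_const_const (lam - Omegap) (one_ne_zero) atTop)
  have hD1 : Asymptotics.IsBigO atTop
      (fun x => (lam - c x) ^ 2 / a x ^ 2 - (lam - Omegap) ^ 2 / S x ^ 2)
      (fun _ => (1 : ℝ)) := by
    have t1 : Asymptotics.IsBigO atTop
        (fun x => -((c x - Omegap) * (lam - c x + (lam - Omegap)) * (a x)⁻¹ ^ 2))
        (fun _ => (1 : ℝ)) := by
      refine (((hc_p.mul hl2).mul (haI.pow 2)).neg_left).congr_right fun x => ?_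
      have := hEpos x
      simp only [hE] at this ⊢
      field_simp
    refine (t1.add (hinv.const_mul_left ((lam - Omegap) ^ 2))).congr_left fun x => ?_
    have := (ha_pos x).ne'
    have := (hSpos x).ne'
    field_simp
    ring
  have hD2 : Asymptotics.IsBigO atTop
      (fun x => (a x * deriv c x + deriv a x * (lam - c x)) / a x ^ 3
        - kappap * (lam - Omegap) / S x ^ 2)
      (fun _ => (1 : ℝ)) := by
    have t1 : Asymptotics.IsBigO atTop (fun x => deriv c x * (a x)⁻¹ ^ 2)
        (fun _ => (1 : ℝ)) := by
      refine (hc'_p.mul (haI.pow 2)).congr_right fun x => ?_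
      have := hEpos x
      simp only [hE] at this ⊢
      field_simp
    have t2 : Asymptotics.IsBigO atTop
        (fun x => (deriv a x - kappap * a x) * (lam - c x) * (a x)⁻¹ ^ 3)
        (fun _ => (1 : ℝ)) := by
      refine ((ha'a.mul hl).mul (haI.pow 3)).congr_right fun x => ?_
      have := hEpos x
      simp only [hE] at this ⊢
      field_simp
    have t3 : Asymptotics.IsBigO atTop
        (fun x => (c x - Omegap) * (a x)⁻¹ ^ 2)
        (fun _ => (1 : ℝ)) := by
      refine (hc_p.mul (haI.pow 2)).congr_right fun x => ?_
      have := hEpos x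
      simp only [hE] at this ⊢
      field_simp
    refine (((t1.add t2).sub (t3.const_mul_left kappap)).add
      (hinv.const_mul_left (kappap * (lam - Omegap)))).congr_left fun x => ?_
    have := (ha_pos x).ne'
    have := (hSpos x).ne'
    field_simp
    ring
  have hac := ha_C1.continuous
  have hcc := hc_C1.continuous
  have hac' := ha_C1.continuous_deriv le_rfl
  have hcc' := hc_C1.continuous_deriv le_rfl
  obtain ⟨M1, hM1, hB1⟩ := aux_bdd _ (by
    refine Continuous.sub (Continuous.div (by fun_prop) (by fun_prop) fun x => ?_)
      (Continuous.div (by fun_prop) (by fun_prop) fun x => ?_)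
    · exact pow_ne_zero _ (ha_pos x).ne'
    · exact pow_ne_zero _ (hSpos x).ne') hD1 (φ X₀)
  obtain ⟨M2, hM2, hB2⟩ := aux_bdd _ (by
    refine Continuous.sub (Continuous.div (by fun_prop) (by fun_prop) fun x => ?_)
      (Continuous.div (by fun_prop) (by fun_prop) fun x => ?_)
    · exact pow_ne_zero _ (ha_pos x).ne'
    · exact pow_ne_zero _ (hSpos x).ne') hD2 (φ X₀)
  refine ⟨M1 + M2, by positivity, fun X hX => ?_⟩
  have hX' : X ∈ Ioo 0 A := ⟨hX₀.1.trans hX.1, hX.2⟩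
  have hle : φ X₀ ≤ φ X := by
    rw [← hgstrict.le_iff_le, hgφ X hX', hgφ X₀ hX₀]
    exact hX.1.le
  have b1 := hB1 (φ X) hle
  have b2 := hB2 (φ X) hle
  have hSX : S (φ X) = -kappap * (A - X) := by rw [hSg, hgφ X hX']
  rw [hSX] at b1 b2
  have hAX : A - X ≠ 0 := (sub_pos.2 hX.2).ne'
  have key : Q X -
          ((((lam - Omegap) / kappap : ℝ) : ℂ) ^ 2 +
              Complex.I * (((lam - Omegap) / kappap : ℝ) : ℂ)) /
            ((A - X : ℝ) : ℂ) ^ 2 =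
      (((lam - c (φ X)) ^ 2 / a (φ X) ^ 2
        - (lam - Omegap) ^ 2 / (-kappap * (A - X)) ^ 2 : ℝ) : ℂ) +
      Complex.I * (((a (φ X) * deriv c (φ X) + deriv a (φ X) * (lam - c (φ X))) / a (φ X) ^ 3
        - kappap * (lam - Omegap) / (-kappap * (A - X)) ^ 2 : ℝ) : ℂ) := by
    have r1 : (lam - Omegap) ^ 2 / (-kappap * (A - X)) ^ 2 =
      ((lam - Omegap) / kappap) ^ 2 / (A - X) ^ 2 := by
      have := hkp.ne
      field_simp
    have r2 : kappap * (lam - Omegap) / (-kappap * (A - X)) ^ 2 =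
      ((lam - Omegap) / kappap) / (A - X) ^ 2 := by
      have := hkp.ne
      field_simp
    rw [hQ, r1, r2]
    push_cast
    ring
  rw [key]
  refine (norm_add_le _ _).trans (add_le_add ?_ ?_)
  · rw [Complex.norm_real]
    exact b1
  · rw [norm_mul, Complex.norm_I, one_mul, Complex.norm_real]
    exact b2
end
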